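/- arXiv:1609.00830 — 3 statements merged into one kernel-verified Lean document; each statement's English description precedes it below -/
import Mathlib

section
/- Let d ≥ 2, let u ≥ v be squarefree monomials of degree d in k[x₁,…,xₙ] with u = x_i x_{i₂} ⋯ x_{i_d}, i < i₂ < ⋯ < i_d, let Δ be the simplicial complex on [n] with I_Δ = (L(u,v)), let Δ₁ be the full simplex on {1,…,i−1}, and let Δ₂ be the complex of the ideal generated by L(u,v) in k[x_i,…,xₙ]. If Δ₂ is strictly CM_t for some t ≥ 1, then Δ = Δ₁ ∗ Δ₂ is strictly CM_{(i−1)+t}. -/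
open Finset

/-- An abstract simplicial complex on the vertex type `V`: a collection of
finite subsets of `V` (the faces) closed under passing to subsets. -/
structure SComplex (V : Type*) where
  faces : Set (Finset V)
  down_closed : ∀ ⦃F G : Finset V⦄, F ∈ faces → G ⊆ F → G ∈ faces

namespace SComplex

variable {V : Type*} [DecidableEq V]

/-- The vertex set of a simplicial complex. -/
def vertexSet (Δ : SComplex V) : Set V := {v | {v} ∈ Δ.faces}

/-- A facet is a maximal face. -/
def IsFacet (Δ : SComplex V) (F : Finset V) : Prop :=
  F ∈ Δ.faces ∧ ∀ G ∈ Δ.faces, F ⊆ G → F = G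

/-- A complex is pure if all of its facets have the same dimension (cardinality). -/
def Pure (Δ : SComplex V) : Prop :=
  ∀ ⦃F G⦄, Δ.IsFacet F → Δ.IsFacet G → F.card = G.card

/-- One more than the dimension: the largest cardinality of a face of `Δ`.
So `Δ.dimSucc = d` means `Δ` has dimension `d - 1`. -/
noncomputable def dimSucc (Δ : SComplex V) : ℕ :=
  sSup {n | ∃ F ∈ Δ.faces, F.card = n}

/-- The link of a face `F` : `link Δ F = {G ∈ Δ : G ∪ F ∈ Δ, G ∩ F = ∅}`. -/
def link (Δ : SComplex V) (F : Finset V) : SComplex V where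
  faces := {G | G ∈ Δ.faces ∧ Disjoint G F ∧ G ∪ F ∈ Δ.faces}
  down_closed := by
    rintro G H ⟨hG, hdis, hGF⟩ hHG
    exact ⟨Δ.down_closed hG hHG, Finset.disjoint_of_subset_left hHG hdis,
      Δ.down_closed hGF (Finset.union_subset_union_left hHG)⟩

/-- A complex is connected if it has a vertex and any two vertices are joined
by a path of edges (connectivity of the 1-skeleton). -/
def Connected (Δ : SComplex V) : Prop :=
  (∃ v, {v} ∈ Δ.faces) ∧
    ∀ a b : V, {a} ∈ Δ.faces → {b} ∈ Δ.faces →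
      Relation.ReflTransGen (fun x y => x ≠ y ∧ ({x, y} : Finset V) ∈ Δ.faces) a b

/-- The join of two simplicial complexes (on disjoint vertex sets):
`Δ₁ ∗ Δ₂ = {F ∪ G : F ∈ Δ₁, G ∈ Δ₂}`. -/
def join (Δ₁ Δ₂ : SComplex V) : SComplex V where
  faces := {H | ∃ F ∈ Δ₁.faces, ∃ G ∈ Δ₂.faces, H = F ∪ G}
  down_closed := by
    rintro H H' ⟨F, hF, G, hG, rfl⟩ hsub
    refine ⟨H' ∩ F, Δ₁.down_closed hF inter_subset_right,
      H' \ F, Δ₂.down_closed hG ?_, ?_⟩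
    · intro x hx
      rcases Finset.mem_sdiff.mp hx with ⟨hx1, hx2⟩
      rcases Finset.mem_union.mp (hsub hx1) with h | h
      · exact absurd h hx2
      · exact h
    · ext x
      by_cases hx : x ∈ F <;>
        simp only [Finset.mem_union, Finset.mem_inter, Finset.mem_sdiff, hx] <;> tauto

/-- The full simplex on a finite vertex set `W`. -/
def simplexOn (W : Finset V) : SComplex V :=
  ⟨{F | F ⊆ W}, fun _ _ hF hG => hG.trans hF⟩

/-- A shelling of `Δ`: an ordering `l` of all the facets of `Δ` such that each
facet meets the union of the previous ones in a nonempty union of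
codimension-one faces of it. -/
def IsShelling (Δ : SComplex V) (l : List (Finset V)) : Prop :=
  l.Nodup ∧ (∀ F, F ∈ l ↔ Δ.IsFacet F) ∧
    ∀ i j : ℕ, j < i → i < l.length →
      ∃ m, m < i ∧ ∃ v ∈ l[i]!,
        l[i]! ∩ l[j]! ⊆ l[i]! ∩ l[m]! ∧ l[i]! ∩ l[m]! = l[i]!.erase v

/-- A complex is shellable if its facets admit a shelling order. -/
def Shellable (Δ : SComplex V) : Prop := ∃ l, IsShelling Δ l

/-- The reduced homology `H̃₀(Δ; k)` vanishes: every `k`-linear combination of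
vertices of `Δ` with coefficient sum zero is a `k`-linear combination of
boundaries of edges of `Δ`. -/
def ReducedH0Vanishes (k : Type*) [Field k] (Δ : SComplex V) : Prop :=
  ∀ f : V →₀ k, (∀ v ∈ f.support, {v} ∈ Δ.faces) → (f.sum fun _ c => c) = 0 →
    f ∈ Submodule.span k {g : V →₀ k | ∃ a b : V, a ≠ b ∧ ({a, b} : Finset V) ∈ Δ.faces ∧
      g = Finsupp.single a 1 - Finsupp.single b 1}

end SComplex

/-- A commutative ring satisfies Serre's condition `S₂` if for every prime `p`
the localization at `p` contains, inside its maximal ideal, a regular sequence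
of length at least `min 2 (dim R_p)`. -/
def RingSerreS2 (R : Type*) [CommRing R] : Prop :=
  ∀ (p : Ideal R) [p.IsPrime],
    ∃ rs : List (Localization.AtPrime p),
      (∀ r ∈ rs, r ∈ IsLocalRing.maximalIdeal (Localization.AtPrime p)) ∧
      RingTheory.Sequence.IsRegular (Localization.AtPrime p) rs ∧
      min 2 (ringKrullDim (Localization.AtPrime p)) ≤ (rs.length : WithBot ℕ∞)

section GroundSet

/-- The squarefree monomial `∏_{i ∈ S} xᵢ` in the polynomial ring whose
variables are indexed by the ground set `W ⊆ ℕ`. -/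
noncomputable def monoW (k : Type*) [CommRing k] (W S : Finset ℕ) :
    MvPolynomial {x // x ∈ W} k :=
  ∏ i ∈ S.subtype (· ∈ W), MvPolynomial.X i

/-- The Stanley–Reisner ideal of a complex `Δ` with ground (vertex) set `W ⊆ ℕ`,
inside the polynomial ring `k[xᵢ : i ∈ W]`: it is generated by the squarefree
monomials of the non-faces contained in `W`. -/
noncomputable def srIdealW (k : Type*) [CommRing k] (W : Finset ℕ) (Δ : SComplex ℕ) :
    Ideal (MvPolynomial {x // x ∈ W} k) :=
  Ideal.span {p | ∃ F : Finset ℕ, F ⊆ W ∧ F ∉ Δ.faces ∧ p = monoW k W F}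

/-- The Stanley–Reisner ring `k[Δ]` of a complex with ground set `W ⊆ ℕ`. -/
abbrev srRingW (k : Type*) [CommRing k] (W : Finset ℕ) (Δ : SComplex ℕ) :=
  MvPolynomial {x // x ∈ W} k ⧸ srIdealW k W Δ

/-- The irrelevant maximal ideal of the Stanley–Reisner ring. -/
noncomputable def srIrrelevantW (k : Type*) [CommRing k] (W : Finset ℕ)
    (Δ : SComplex ℕ) : Ideal (srRingW k W Δ) :=
  (Ideal.span (Set.range (MvPolynomial.X : {x // x ∈ W} → MvPolynomial {x // x ∈ W} k))).map
    (Ideal.Quotient.mk (srIdealW k W Δ))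

/-- `Δ` (a complex with ground set `W ⊆ ℕ`) is Cohen–Macaulay over the field `k`:
the ring `k[Δ]` admits a regular sequence, inside the irrelevant maximal ideal,
whose length equals the Krull dimension of `k[Δ]`. -/
def IsCMW (k : Type*) [Field k] (W : Finset ℕ) (Δ : SComplex ℕ) : Prop :=
  ∃ rs : List (srRingW k W Δ), (∀ r ∈ rs, r ∈ srIrrelevantW k W Δ) ∧
    RingTheory.Sequence.IsRegular (srRingW k W Δ) rs ∧
    ringKrullDim (srRingW k W Δ) = (rs.length : WithBot ℕ∞)

/-- `Δ` is `CM_t` (Cohen–Macaulay in codimension `t`) over `k`: `Δ` is pure and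
`link_Δ(F)` is Cohen–Macaulay over `k` for every face `F` with `#F ≥ t`.
`CM_1` is the Buchsbaum property. -/
def IsCMtW (k : Type*) [Field k] (W : Finset ℕ) (t : ℕ) (Δ : SComplex ℕ) : Prop :=
  Δ.Pure ∧ ∀ F ∈ Δ.faces, t ≤ F.card → IsCMW k W (Δ.link F)

end GroundSet

section Lex

/-- Comparison of squarefree monomials of the same degree in the lexicographic
order with `x₁ > x₂ > ⋯ > xₙ`, the monomials being identified with their
supports: `u >_lex v` iff the smallest variable index where they differ
belongs to `u`. -/
def lexGT (A B : Finset ℕ) : Prop :=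
  ∃ m ∈ A, m ∉ B ∧ ∀ x < m, (x ∈ A ↔ x ∈ B)

/-- `u ≥_lex v` for squarefree monomials identified with their supports. -/
def lexGE (A B : Finset ℕ) : Prop := A = B ∨ lexGT A B

/-- The lexsegment `L(u,v)` of squarefree monomials of degree `d` in
`x₁, …, xₙ`, the monomials being identified with their supports:
all `S ⊆ [n] = {1, …, n}` with `#S = d` and `u ≥_lex S ≥_lex v`. -/
def lexSegment (n d : ℕ) (U V₀ : Finset ℕ) : Set (Finset ℕ) :=
  {S | S ⊆ Finset.Icc 1 n ∧ S.card = d ∧ lexGE U S ∧ lexGE S V₀}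

/-- The ideal of `k[xᵢ : i ∈ W]` generated by the squarefree monomials of the
lexsegment `L(u,v)` (of degree-`d` squarefree monomials in `x₁, …, xₙ`). -/
noncomputable def lexIdealW (k : Type*) [CommRing k] (W : Finset ℕ) (n d : ℕ)
    (U V₀ : Finset ℕ) : Ideal (MvPolynomial {x // x ∈ W} k) :=
  Ideal.span {p | ∃ S ∈ lexSegment n d U V₀, p = monoW k W S}

end Lex

/-- The ring `R` has a regular sequence inside `m` whose length is the Krull dimension of `R`. -/
def HasMaximalRegularSequence (R : Type*) [CommRing R] (m : Ideal R) : Prop :=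
  ∃ rs : List R, (∀ r ∈ rs, r ∈ m) ∧ RingTheory.Sequence.IsRegular R rs ∧
    ringKrullDim R = (rs.length : WithBot ℕ∞)

theorem HasMaximalRegularSequence.of_ringEquiv {R S : Type*} [CommRing R] [CommRing S]
    {m : Ideal R} {m' : Ideal S} (e : R ≃+* S) (hm : m ≤ m'.comap (e : R →+* S))
    (h : HasMaximalRegularSequence R m) : HasMaximalRegularSequence S m' := by
  obtain ⟨rs, hrs, hreg, hdim⟩ := h
  refine ⟨rs.map e, ?_, ?_, ?_⟩
  · simp only [List.mem_map, forall_exists_index, and_imp, forall_apply_eq_imp_iff₂]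
    exact fun r hr => hm (hrs r hr)
  · refine (AddEquiv.isRegular_congr (e := e.toAddEquiv) ?_).mp hreg
    exact List.forall₂_map_right_iff.mpr (List.forall₂_same.mpr fun r _ x => by simp)
  · rw [← ringKrullDim_eq_of_ringEquiv e, hdim, List.length_map]

open scoped Pointwise in
theorem isRegular_X_cons_map_C {R : Type*} [CommRing R] {rs : List R}
    (h : RingTheory.Sequence.IsRegular R rs) :
    RingTheory.Sequence.IsRegular (Polynomial R) (Polynomial.X :: rs.map Polynomial.C) := by
  refine RingTheory.Sequence.IsRegular.cons ?_ ?_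
  · intro p q hpq
    exact Polynomial.isRegular_X.left hpq
  · let f : Polynomial R →+ R := (Polynomial.constantCoeff : Polynomial R →+* R)
    have hf : Function.Surjective f := fun r => ⟨Polynomial.C r, by simp [f]⟩
    have hker : ((Polynomial.X : Polynomial R) •
        (⊤ : Submodule (Polynomial R) (Polynomial R))).toAddSubgroup = f.ker := by
      ext p
      simp only [Submodule.mem_toAddSubgroup, Submodule.mem_smul_pointwise_iff_exists,
        Submodule.mem_top, true_and, smul_eq_mul, AddMonoidHom.mem_ker]
      change (∃ b, Polynomial.X * b = p) ↔ p.coeff 0 = 0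
      rw [← Polynomial.X_dvd_iff]
      exact ⟨fun ⟨b, hb⟩ => ⟨b, hb.symm⟩, fun ⟨b, hb⟩ => ⟨b, hb.symm⟩⟩
    let e : QuotSMulTop (Polynomial.X : Polynomial R) (Polynomial R) ≃+ R :=
      (QuotientAddGroup.quotientAddEquivOfEq hker).trans
        (QuotientAddGroup.quotientKerEquivOfSurjective f hf)
    refine (AddEquiv.isRegular_congr (e := e) ?_).mpr h
    refine List.forall₂_map_left_iff.mpr (List.forall₂_same.mpr fun r _ x => ?_)
    obtain ⟨p, rfl⟩ := Submodule.Quotient.mk_surjective _ x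
    change (Polynomial.C r * p).coeff 0 = r * p.coeff 0
    exact Polynomial.coeff_C_mul p

theorem HasMaximalRegularSequence.polynomial {R : Type*} [CommRing R] [IsNoetherianRing R]
    {m : Ideal R} (h : HasMaximalRegularSequence R m) :
    HasMaximalRegularSequence (Polynomial R) (m.map Polynomial.C ⊔ Ideal.span {Polynomial.X}) := by
  obtain ⟨rs, hrs, hreg, hdim⟩ := h
  refine ⟨_, ?_, isRegular_X_cons_map_C hreg, ?_⟩
  · simp only [List.mem_cons, List.mem_map]
    rintro _ (rfl | ⟨r, hr, rfl⟩)
    · exact Ideal.mem_sup_right (Ideal.mem_span_singleton_self _)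
    · exact Ideal.mem_sup_left (Ideal.mem_map_of_mem _ (hrs r hr))
  · rw [Polynomial.ringKrullDim_of_isNoetherianRing, hdim]
    simp

theorem hom_monoW {k T : Type*} [CommRing k] [CommRing T] {W F : Finset ℕ} (hF : F ⊆ W)
    (φ : MvPolynomial {x // x ∈ W} k →+* T) (g : ℕ → T)
    (hg : ∀ w : {x // x ∈ W}, φ (MvPolynomial.X w) = g w) :
    φ (monoW k W F) = ∏ x ∈ F, g x := by
  rw [monoW, map_prod, Finset.prod_congr rfl fun w _ => hg w,
    Finset.prod_subtype_of_mem g fun x hx => hF hx]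

theorem monoW_mem_span_iff {k : Type*} [Field k] {W F : Finset ℕ} {𝒮 : Set (Finset ℕ)}
    (h𝒮 : ∀ S ∈ 𝒮, S ⊆ W) (hF : F ⊆ W) :
    monoW k W F ∈ Ideal.span {p | ∃ S ∈ 𝒮, p = monoW k W S} ↔ ∃ S ∈ 𝒮, S ⊆ F := by
  constructor
  · intro h
    by_contra! hS
    let g : ℕ → k := fun x => if x ∈ F then 1 else 0
    let φ : MvPolynomial {x // x ∈ W} k →+* k := MvPolynomial.eval fun w => g w
    have hφ : ∀ w : {x // x ∈ W}, φ (MvPolynomial.X w) = g w := fun w => by simp [φ]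
    have hle : Ideal.span {p | ∃ S ∈ 𝒮, p = monoW k W S} ≤ RingHom.ker φ := by
      rw [Ideal.span_le]
      rintro _ ⟨S, hS', rfl⟩
      obtain ⟨x, hx, hxF⟩ := Finset.not_subset.mp (hS S hS')
      rw [SetLike.mem_coe, RingHom.mem_ker, hom_monoW (h𝒮 S hS') φ g hφ]
      exact Finset.prod_eq_zero hx (if_neg hxF)
    have h0 := hle h
    rw [RingHom.mem_ker, hom_monoW hF φ g hφ, Finset.prod_congr rfl fun x hx => if_pos hx] at h0
    simp at h0
  · rintro ⟨S, hS, hSF⟩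
    refine Ideal.mem_of_dvd _ (Finset.prod_dvd_prod_of_subset _ _ _ ?_)
      (Ideal.subset_span ⟨S, hS, rfl⟩)
    intro w hw
    rw [Finset.mem_subtype] at hw ⊢
    exact hSF hw

theorem monoW_mem_srIdealW_iff {k : Type*} [Field k] {W F : Finset ℕ} (Δ : SComplex ℕ)
    (hF : F ⊆ W) : monoW k W F ∈ srIdealW k W Δ ↔ F ∉ Δ.faces := by
  have h := monoW_mem_span_iff (k := k) (𝒮 := {F | F ⊆ W ∧ F ∉ Δ.faces}) (fun S hS => hS.1) hF
  simp only [Set.mem_ofPred_eq, and_assoc] at h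
  rw [srIdealW, h]
  exact ⟨fun ⟨S, _, hS, hSF⟩ hFΔ => hS (Δ.down_closed hFΔ hSF), fun h => ⟨F, hF, h, Subset.rfl⟩⟩

theorem isCMW_congr {k : Type*} [Field k] {W : Finset ℕ} {Δ Γ : SComplex ℕ}
    (h : ∀ F ⊆ W, (F ∈ Δ.faces ↔ F ∈ Γ.faces)) : IsCMW k W Δ ↔ IsCMW k W Γ := by
  have hI : srIdealW k W Δ = srIdealW k W Γ := by
    unfold srIdealW
    congr 1
    ext p
    exact exists_congr fun F => and_congr_right fun hF => by rw [h F hF]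
  have key : ∀ I J : Ideal (MvPolynomial {x // x ∈ W} k), I = J →
      ∀ K : Ideal (MvPolynomial {x // x ∈ W} k),
      (HasMaximalRegularSequence (_ ⧸ I) (K.map (Ideal.Quotient.mk I)) ↔
        HasMaximalRegularSequence (_ ⧸ J) (K.map (Ideal.Quotient.mk J))) := by
    rintro I _ rfl K
    rfl
  exact key _ _ hI _

section Variables

variable {k : Type*} [Field k] {W : Finset ℕ} {a : ℕ} {Γ : SComplex ℕ}

/-- The class of `xᵢ` in the Stanley–Reisner ring, or `0` if `i` is not in the ground set. -/
noncomputable def srVar (k : Type*) [Field k] (W : Finset ℕ) (Γ : SComplex ℕ) (i : ℕ) :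
    srRingW k W Γ :=
  if h : i ∈ W then Ideal.Quotient.mk _ (MvPolynomial.X ⟨i, h⟩) else 0

theorem mk_X_eq_srVar (w : {x // x ∈ W}) :
    Ideal.Quotient.mk (srIdealW k W Γ) (MvPolynomial.X w) = srVar k W Γ w := by
  simp [srVar]

theorem srVar_mem_srIrrelevantW (i : ℕ) : srVar k W Γ i ∈ srIrrelevantW k W Γ := by
  unfold srVar
  split_ifs
  · exact Ideal.mem_map_of_mem _ (Ideal.subset_span ⟨_, rfl⟩)
  · exact zero_mem _

theorem srIrrelevantW_le_iff {I : Ideal (srRingW k W Γ)} :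
    srIrrelevantW k W Γ ≤ I ↔ ∀ i ∈ W, srVar k W Γ i ∈ I := by
  rw [srIrrelevantW, Ideal.map_le_iff_le_comap, Ideal.span_le, Set.range_subset_iff, Subtype.forall]
  refine forall₂_congr fun i hi => ?_
  rw [SetLike.mem_coe, Ideal.mem_comap, mk_X_eq_srVar]

theorem prod_srVar_eq_zero {F : Finset ℕ} (hFW : F ⊆ W) (hF : F ∉ Γ.faces) :
    ∏ x ∈ F, srVar k W Γ x = 0 := by
  rw [← hom_monoW (k := k) hFW (Ideal.Quotient.mk (srIdealW k W Γ)) _ mk_X_eq_srVar,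
    Ideal.Quotient.eq_zero_iff_mem]
  exact (monoW_mem_srIdealW_iff Γ hFW).mpr hF

/-- The homomorphism out of `k[Γ]` sending `xᵢ` to `g i`, when `g` kills all nonfaces. -/
noncomputable def srLift {T : Type*} [CommRing T] [Algebra k T] (W : Finset ℕ) (Γ : SComplex ℕ)
    (g : ℕ → T) (hg : ∀ F ⊆ W, F ∉ Γ.faces → ∏ x ∈ F, g x = 0) : srRingW k W Γ →ₐ[k] T :=
  Ideal.Quotient.liftₐ (srIdealW k W Γ) (MvPolynomial.aeval fun w : {x // x ∈ W} => g w) <| by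
    change srIdealW k W Γ ≤ RingHom.ker _
    rw [srIdealW, Ideal.span_le]
    rintro _ ⟨F, hFW, hF, rfl⟩
    exact (hom_monoW hFW (MvPolynomial.aeval (R := k)
      fun w : {x // x ∈ W} => g w).toRingHom g (fun w => by simp)).trans (hg F hFW hF)

theorem srLift_srVar {T : Type*} [CommRing T] [Algebra k T] (g : ℕ → T)
    (hg : ∀ F ⊆ W, F ∉ Γ.faces → ∏ x ∈ F, g x = 0) {i : ℕ} (hi : i ∈ W) :
    srLift W Γ g hg (srVar k W Γ i) = g i := by
  rw [srVar, dif_pos hi]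
  exact (Ideal.Quotient.liftₐ_apply _ _ _ _).trans (MvPolynomial.aeval_X _ _)

theorem srRingW_algHom_ext {T : Type*} [CommRing T] [Algebra k T] {f g : srRingW k W Γ →ₐ[k] T}
    (h : ∀ i ∈ W, f (srVar k W Γ i) = g (srVar k W Γ i)) : f = g := by
  refine Ideal.Quotient.algHom_ext _ (MvPolynomial.algHom_ext fun w => ?_)
  have := h w w.2
  rw [← mk_X_eq_srVar] at this
  exact this

/-- The map `k[Γ] → k[Γ]` induced by adding `a` to the ground set. -/
noncomputable def srInsertHom (k : Type*) [Field k] (W : Finset ℕ) (a : ℕ) (Γ : SComplex ℕ) :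
    srRingW k W Γ →ₐ[k] srRingW k (insert a W) Γ :=
  srLift W Γ (srVar k (insert a W) Γ) fun _ hFW hF =>
    prod_srVar_eq_zero (hFW.trans (Finset.subset_insert a W)) hF

theorem srInsertHom_srVar {i : ℕ} (hi : i ∈ W) :
    srInsertHom k W a Γ (srVar k W Γ i) = srVar k (insert a W) Γ i :=
  srLift_srVar _ _ hi

theorem isCMW_insert_iff_of_notMem (ha : a ∉ W) (haΓ : {a} ∉ Γ.faces) :
    IsCMW k (insert a W) Γ ↔ IsCMW k W Γ := by
  have hsub : ({a} : Finset ℕ) ⊆ insert a W := by simp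
  have hva : srVar k (insert a W) Γ a = 0 := by
    simpa using prod_srVar_eq_zero (k := k) hsub haΓ
  have hva' : srVar k W Γ a = 0 := dif_neg ha
  let φ : srRingW k (insert a W) Γ →ₐ[k] srRingW k W Γ :=
    srLift (insert a W) Γ (srVar k W Γ) fun F hFW hF => by
      by_cases haF : a ∈ F
      · exact Finset.prod_eq_zero haF hva'
      · exact prod_srVar_eq_zero ((Finset.subset_insert_iff_of_notMem haF).mp hFW) hF
  have hφ : ∀ i ∈ insert a W, φ (srVar k _ Γ i) = srVar k W Γ i := fun i hi => srLift_srVar _ _ hi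
  let e : srRingW k (insert a W) Γ ≃ₐ[k] srRingW k W Γ :=
    AlgEquiv.ofAlgHom φ (srInsertHom k W a Γ)
      (srRingW_algHom_ext fun i hi => by
        simp [srInsertHom_srVar hi, hφ i (Finset.mem_insert_of_mem hi)])
      (srRingW_algHom_ext fun i hi => by
        rw [AlgHom.comp_apply, hφ i hi]
        rcases Finset.mem_insert.mp hi with rfl | hi
        · simp [hva, hva']
        · simp [srInsertHom_srVar hi])
  refine ⟨fun h => HasMaximalRegularSequence.of_ringEquiv e.toRingEquiv ?_ h,
    fun h => HasMaximalRegularSequence.of_ringEquiv e.symm.toRingEquiv ?_ h⟩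
  · refine srIrrelevantW_le_iff.mpr fun i hi => ?_
    change φ _ ∈ srIrrelevantW k W Γ
    rw [hφ i hi]
    exact srVar_mem_srIrrelevantW i
  · refine srIrrelevantW_le_iff.mpr fun i hi => ?_
    change srInsertHom k W a Γ _ ∈ srIrrelevantW k (insert a W) Γ
    rw [srInsertHom_srVar hi]
    exact srVar_mem_srIrrelevantW i

theorem IsCMW.insert_cone (ha : a ∉ W) (hcone : ∀ F ⊆ W, F ∈ Γ.faces → insert a F ∈ Γ.faces)
    (h : IsCMW k W Γ) : IsCMW k (insert a W) Γ := by
  let g : ℕ → Polynomial (srRingW k W Γ) := fun x =>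
    if x = a then Polynomial.X else Polynomial.C (srVar k W Γ x)
  have hga : g a = Polynomial.X := if_pos rfl
  have hgW : ∀ i ∈ W, g i = Polynomial.C (srVar k W Γ i) := fun i hi =>
    if_neg (ne_of_mem_of_not_mem hi ha)
  let φ : srRingW k (insert a W) Γ →ₐ[k] Polynomial (srRingW k W Γ) :=
    srLift (insert a W) Γ g fun F hFW hF => by
      have hFe : F.erase a ⊆ W := Finset.subset_insert_iff.mp hFW
      have hFe' : F.erase a ∉ Γ.faces := fun h =>
        hF (Γ.down_closed (hcone _ hFe h) (Finset.subset_insert_iff.mpr Subset.rfl))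
      have h0 : ∏ x ∈ F.erase a, g x = 0 := by
        rw [Finset.prod_congr rfl fun x hx => hgW x (hFe hx), ← map_prod,
          prod_srVar_eq_zero hFe hFe', map_zero]
      exact zero_dvd_iff.mp
        (h0 ▸ Finset.prod_dvd_prod_of_subset _ _ g (Finset.erase_subset a F))
  have hφ : ∀ i ∈ insert a W, φ (srVar k _ Γ i) = g i := fun i hi => srLift_srVar _ _ hi
  have haW : a ∈ insert a W := Finset.mem_insert_self a W
  let ψ : Polynomial (srRingW k W Γ) →ₐ[k] srRingW k (insert a W) Γ :=
    Polynomial.eval₂AlgHom (srInsertHom k W a Γ) (srVar k (insert a W) Γ a)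
      fun _ => Commute.all _ _
  have hψX : ψ Polynomial.X = srVar k (insert a W) Γ a := by simp [ψ]
  have hψC : ∀ r, ψ (Polynomial.C r) = srInsertHom k W a Γ r := fun r => by simp [ψ]
  let e : Polynomial (srRingW k W Γ) ≃ₐ[k] srRingW k (insert a W) Γ :=
    AlgEquiv.ofAlgHom ψ φ
      (srRingW_algHom_ext fun i hi => by
        rw [AlgHom.comp_apply, hφ i hi]
        rcases Finset.mem_insert.mp hi with rfl | hi
        · rw [hga, hψX, AlgHom.id_apply]
        · rw [hgW i hi, hψC, srInsertHom_srVar hi, AlgHom.id_apply])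
      (by
        refine Polynomial.algHom_ext' ?_ ?_
        · refine srRingW_algHom_ext (T := Polynomial (srRingW k W Γ)) fun i hi => ?_
          change φ (ψ (Polynomial.C _)) = Polynomial.C _
          rw [hψC, srInsertHom_srVar hi, hφ i (Finset.mem_insert_of_mem hi), hgW i hi]
        · rw [AlgHom.comp_apply, hψX, hφ a haW, hga, AlgHom.id_apply])
  refine HasMaximalRegularSequence.of_ringEquiv e.toRingEquiv ?_
    (HasMaximalRegularSequence.polynomial h)
  refine sup_le (Ideal.map_le_iff_le_comap.mpr (srIrrelevantW_le_iff.mpr fun i hi => ?_)) ?_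
  · change ψ (Polynomial.C _) ∈ srIrrelevantW k (insert a W) Γ
    rw [hψC, srInsertHom_srVar hi]
    exact srVar_mem_srIrrelevantW i
  · rw [Ideal.span_singleton_le_iff_mem]
    change ψ Polynomial.X ∈ srIrrelevantW k (insert a W) Γ
    rw [hψX]
    exact srVar_mem_srIrrelevantW a

theorem isCMW_union_iff_of_notMem {A : Finset ℕ} (hA : Disjoint A W)
    (haΓ : ∀ a ∈ A, {a} ∉ Γ.faces) : IsCMW k (A ∪ W) Γ ↔ IsCMW k W Γ := by
  induction A using Finset.induction_on with
  | empty => simp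
  | insert a A haA ih =>
    rw [Finset.disjoint_insert_left] at hA
    rw [Finset.insert_union, isCMW_insert_iff_of_notMem (by simp [haA, hA.1])
      (haΓ a (Finset.mem_insert_self a A)),
      ih hA.2 fun b hb => haΓ b (Finset.mem_insert_of_mem hb)]

theorem IsCMW.union {A : Finset ℕ} (hA : Disjoint A W)
    (haΓ : ∀ a ∈ A, {a} ∉ Γ.faces ∨ ∀ F ∈ Γ.faces, insert a F ∈ Γ.faces)
    (h : IsCMW k W Γ) : IsCMW k (A ∪ W) Γ := by
  induction A using Finset.induction_on with
  | empty => simpa using h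
  | insert a A haA ih =>
    rw [Finset.disjoint_insert_left] at hA
    have ha : a ∉ A ∪ W := by simp [haA, hA.1]
    have hAW := ih hA.2 fun b hb => haΓ b (Finset.mem_insert_of_mem hb)
    rw [Finset.insert_union]
    rcases haΓ a (Finset.mem_insert_self a A) with h1 | h1
    · exact (isCMW_insert_iff_of_notMem ha h1).mpr hAW
    · exact hAW.insert_cone ha fun F _ => h1 F

end Variables

theorem lexSegment_subset_Icc {n d i : ℕ} {U V₀ S : Finset ℕ} (himin : ∀ m ∈ U, i ≤ m)
    (hS : S ∈ lexSegment n d U V₀) : S ⊆ Finset.Icc i n := by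
  intro x hx
  refine Finset.mem_Icc.mpr ⟨?_, (Finset.mem_Icc.mp (hS.1 hx)).2⟩
  rcases hS.2.2.1 with rfl | ⟨m, hmU, -, hm⟩
  · exact himin x hx
  · by_contra! hxi
    have := himin m hmU
    have := himin x ((hm x (by omega)).mpr hx)
    omega

theorem mem_faces_iff_of_srIdealW_eq {k : Type*} [Field k] {n d : ℕ} {U V₀ W F : Finset ℕ}
    {Δ : SComplex ℕ} (hW : ∀ S ∈ lexSegment n d U V₀, S ⊆ W)
    (hΔ : srIdealW k W Δ = lexIdealW k W n d U V₀) (hF : F ⊆ W) :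
    F ∈ Δ.faces ↔ ∀ S ∈ lexSegment n d U V₀, ¬ S ⊆ F := by
  rw [← not_iff_not, ← monoW_mem_srIdealW_iff (k := k) Δ hF, hΔ, lexIdealW,
    monoW_mem_span_iff hW hF]
  push Not
  rfl

section SimplexJoin

variable {k : Type*} [Field k] {A W : Finset ℕ} {Δ Γ : SComplex ℕ}

theorem pure_of_inter_mem_faces (hAW : Disjoint A W) (hΔ : ∀ F ∈ Δ.faces, F ⊆ A ∪ W)
    (hΓ : ∀ F ∈ Γ.faces, F ⊆ W) (h : ∀ F ⊆ A ∪ W, (F ∈ Δ.faces ↔ F ∩ W ∈ Γ.faces))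
    (hpure : Γ.Pure) : Δ.Pure := by
  have key : ∀ F, Δ.IsFacet F → Γ.IsFacet (F ∩ W) ∧ F.card = A.card + (F ∩ W).card := by
    rintro F ⟨hF, hmax⟩
    have hFW := (h F (hΔ F hF)).mp hF
    have hext : ∀ G ∈ Γ.faces, F ∩ W ⊆ G → F = A ∪ G := by
      intro G hG hFG
      refine hmax _ ((h _ (Finset.union_subset_union_right (hΓ G hG))).mpr ?_) ?_
      · rwa [Finset.union_inter_distrib_right, Finset.disjoint_iff_inter_eq_empty.mp hAW,
          Finset.empty_union, Finset.inter_eq_left.mpr (hΓ G hG)]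
      · intro x hx
        rcases Finset.mem_union.mp (hΔ F hF hx) with hxA | hxW
        · exact Finset.mem_union_left _ hxA
        · exact Finset.mem_union_right _ (hFG (Finset.mem_inter.mpr ⟨hx, hxW⟩))
    refine ⟨⟨hFW, fun G hG hFG => hFG.antisymm fun x hx => ?_⟩, ?_⟩
    · refine Finset.mem_inter.mpr ⟨?_, hΓ G hG hx⟩
      rw [hext G hG hFG]
      exact Finset.mem_union_right _ hx
    · conv_lhs => rw [hext _ hFW Subset.rfl]
      exact Finset.card_union_of_disjoint (hAW.mono_right Finset.inter_subset_right)
  intro F G hF hG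
  rw [(key F hF).2, (key G hG).2, hpure (key F hF).1 (key G hG).1]

theorem mem_link_faces_iff_of_inter_mem_faces (hΔ : ∀ F ∈ Δ.faces, F ⊆ A ∪ W)
    (h : ∀ F ⊆ A ∪ W, (F ∈ Δ.faces ↔ F ∩ W ∈ Γ.faces)) {F : Finset ℕ} (hF : F ∈ Δ.faces) :
    ∀ G ⊆ W, (G ∈ (Δ.link F).faces ↔ G ∈ (Γ.link (F ∩ W)).faces) := by
  intro G hG
  have hGW : G ⊆ A ∪ W := hG.trans Finset.subset_union_right
  refine and_congr ?_ (and_congr ?_ ?_)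
  · rw [h G hGW, Finset.inter_eq_left.mpr hG]
  · rw [Finset.disjoint_iff_inter_eq_empty, Finset.disjoint_iff_inter_eq_empty,
      ← Finset.inter_assoc, Finset.inter_right_comm, Finset.inter_eq_left.mpr hG]
  · rw [h _ (Finset.union_subset hGW (hΔ F hF)), Finset.union_inter_distrib_right,
      Finset.inter_eq_left.mpr hG]

theorem isCMtW_union_of_inter_mem_faces {t : ℕ} (hAW : Disjoint A W)
    (hΔ : ∀ F ∈ Δ.faces, F ⊆ A ∪ W) (hΓ : ∀ F ∈ Γ.faces, F ⊆ W)
    (h : ∀ F ⊆ A ∪ W, (F ∈ Δ.faces ↔ F ∩ W ∈ Γ.faces)) (hCM : IsCMtW k W t Γ) :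
    IsCMtW k (A ∪ W) (A.card + t) Δ := by
  refine ⟨pure_of_inter_mem_faces hAW hΔ hΓ h hCM.1, fun F hF hcard => ?_⟩
  have hFW := (h F (hΔ F hF)).mp hF
  have hle : t ≤ (F ∩ W).card := by
    have h1 : F ⊆ A ∪ (F ∩ W) := by
      rw [Finset.union_inter_distrib_left]
      exact Finset.subset_inter Finset.subset_union_right (hΔ F hF)
    have := (Finset.card_le_card h1).trans (Finset.card_union_le _ _)
    omega
  refine IsCMW.union hAW (fun a ha => ?_)
    ((isCMW_congr (mem_link_faces_iff_of_inter_mem_faces hΔ h hF)).mpr (hCM.2 _ hFW hle))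
  have haW : a ∉ W := Finset.disjoint_left.mp hAW ha
  have hins : ∀ G ∈ Δ.faces, insert a G ∈ Δ.faces := fun G hG => by
    refine (h _ (Finset.insert_subset (Finset.mem_union_left _ ha) (hΔ G hG))).mpr ?_
    rw [Finset.insert_inter_of_notMem haW]
    exact (h G (hΔ G hG)).mp hG
  by_cases haF : a ∈ F
  · exact Or.inl fun h => Finset.disjoint_singleton_left.mp h.2.1 haF
  · refine Or.inr fun G hG => ⟨hins G hG.1, Finset.disjoint_insert_left.mpr ⟨haF, hG.2.1⟩, ?_⟩
    rw [Finset.insert_union]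
    exact hins _ hG.2.2

theorem isCMtW_of_isCMtW_union {t : ℕ} (hAW : Disjoint A W)
    (hΔ : ∀ F ∈ Δ.faces, F ⊆ A ∪ W) (hΓ : ∀ F ∈ Γ.faces, F ⊆ W)
    (h : ∀ F ⊆ A ∪ W, (F ∈ Δ.faces ↔ F ∩ W ∈ Γ.faces)) (hpure : Γ.Pure)
    (hCM : IsCMtW k (A ∪ W) (A.card + t) Δ) : IsCMtW k W t Γ := by
  refine ⟨hpure, fun F hF hcard => ?_⟩
  have hFW := hΓ F hF
  have hinter : (A ∪ F) ∩ W = F := by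
    rw [Finset.union_inter_distrib_right, Finset.disjoint_iff_inter_eq_empty.mp hAW,
      Finset.empty_union, Finset.inter_eq_left.mpr hFW]
  have hAF : A ∪ F ∈ Δ.faces :=
    (h _ (Finset.union_subset_union_right hFW)).mpr (hinter.symm ▸ hF)
  have hlink := hCM.2 _ hAF (by
    rw [Finset.card_union_of_disjoint (hAW.mono_right hFW)]
    omega)
  have hghost : ∀ a ∈ A, {a} ∉ (Δ.link (A ∪ F)).faces := fun a ha h =>
    Finset.disjoint_singleton_left.mp h.2.1 (Finset.mem_union_left F ha)
  rw [isCMW_union_iff_of_notMem hAW hghost,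
    isCMW_congr (mem_link_faces_iff_of_inter_mem_faces hΔ h hAF), hinter] at hlink
  exact hlink

end SimplexJoin

/-- In the lexsegment setting, if `Δ₂` is strictly `CM_t` for
some `t ≥ 1`, then `Δ = Δ₁ ∗ Δ₂` is strictly `CM_{(i-1)+t}`. -/
theorem lexsegment_strictly_CMt (k : Type*) [Field k] (n d i : ℕ) (hd : 2 ≤ d)
    (U V₀ : Finset ℕ) (hUsub : U ⊆ Finset.Icc 1 n) (hVsub : V₀ ⊆ Finset.Icc 1 n)
    (hUcard : U.card = d) (hVcard : V₀.card = d) (huv : lexGE U V₀)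
    (hiU : i ∈ U) (himin : ∀ m ∈ U, i ≤ m)
    (Δ : SComplex ℕ) (hΔsub : ∀ F ∈ Δ.faces, F ⊆ Finset.Icc 1 n)
    (hΔ : srIdealW k (Finset.Icc 1 n) Δ = lexIdealW k (Finset.Icc 1 n) n d U V₀)
    (Δ₂ : SComplex ℕ) (hΔ₂sub : ∀ F ∈ Δ₂.faces, F ⊆ Finset.Icc i n)
    (hΔ₂ : srIdealW k (Finset.Icc i n) Δ₂ = lexIdealW k (Finset.Icc i n) n d U V₀)
    (t : ℕ) (ht : 1 ≤ t)
    (h2 : IsCMtW k (Finset.Icc i n) t Δ₂)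
    (h2s : ¬ IsCMtW k (Finset.Icc i n) (t - 1) Δ₂) :
    IsCMtW k (Finset.Icc 1 n) ((i - 1) + t) Δ ∧
      ¬ IsCMtW k (Finset.Icc 1 n) ((i - 1) + t - 1) Δ := by
  obtain ⟨hi1, hin⟩ := Finset.mem_Icc.mp (hUsub hiU)
  have hunion : Finset.Icc 1 n = Finset.Icc 1 (i - 1) ∪ Finset.Icc i n := by
    ext x
    simp only [Finset.mem_union, Finset.mem_Icc]
    omega
  have hdisj : Disjoint (Finset.Icc 1 (i - 1)) (Finset.Icc i n) := by
    rw [Finset.disjoint_left]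
    intro x
    simp only [Finset.mem_Icc]
    omega
  have hL : ∀ S ∈ lexSegment n d U V₀, S ⊆ Finset.Icc i n := fun S => lexSegment_subset_Icc himin
  have h : ∀ F ⊆ Finset.Icc 1 n, (F ∈ Δ.faces ↔ F ∩ Finset.Icc i n ∈ Δ₂.faces) := by
    intro F hF
    rw [mem_faces_iff_of_srIdealW_eq (fun S hS => hS.1) hΔ hF,
      mem_faces_iff_of_srIdealW_eq hL hΔ₂ Finset.inter_subset_right]
    refine forall₂_congr fun S hS => not_congr ?_
    rw [Finset.subset_inter_iff, and_iff_left (hL S hS)]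
  have hcard : (Finset.Icc 1 (i - 1)).card = i - 1 := by simp
  rw [hunion] at hΔsub h ⊢
  refine ⟨?_, fun hCM => h2s ?_⟩
  · have := isCMtW_union_of_inter_mem_faces hdisj hΔsub hΔ₂sub h h2
    rwa [hcard] at this
  · refine isCMtW_of_isCMtW_union hdisj hΔsub hΔ₂sub h h2.1 ?_
    rwa [hcard, ← Nat.add_sub_assoc ht]
end

section
/- Let Δ be a pure simplicial complex of dimension d − 1 on [n] over a field k. Then the Stanley-Reisner ring k[Δ] satisfies Serre's condition S₂ if and only if the reduced homology H̃₀(link_Δ(F); k) vanishes for every face F ∈ Δ with #F ≤ d − 2; equivalently, if and only if Δ is pure and link_Δ(F) is connected for every face F ∈ Δ with dim(link_Δ(F)) ≥ 1. -/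
open Finset

section LocalAlgebra

variable {S : Type*} [CommRing S] {I : Ideal S} (p : Ideal (S ⧸ I)) [p.IsPrime]

/-- The canonical map from a ring `S` to the localization of `S ⧸ I` at a prime `p`. -/
noncomputable def quotLoc : S →+* Localization.AtPrime p :=
  (algebraMap (S ⧸ I) (Localization.AtPrime p)).comp (Ideal.Quotient.mk I)

theorem quotLoc_eq_zero_iff {x : S} :
    quotLoc p x = 0 ↔ ∃ s, Ideal.Quotient.mk I s ∉ p ∧ s * x ∈ I := by
  rw [quotLoc, RingHom.comp_apply, IsLocalization.map_eq_zero_iff p.primeCompl]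
  constructor
  · rintro ⟨⟨m, hm⟩, h⟩
    obtain ⟨s, rfl⟩ := Ideal.Quotient.mk_surjective m
    refine ⟨s, hm, ?_⟩
    rwa [← map_mul, Ideal.Quotient.eq_zero_iff_mem] at h
  · rintro ⟨s, hs, h⟩
    refine ⟨⟨Ideal.Quotient.mk I s, hs⟩, ?_⟩
    rwa [← map_mul, Ideal.Quotient.eq_zero_iff_mem]

theorem isUnit_quotLoc_iff {s : S} : IsUnit (quotLoc p s) ↔ Ideal.Quotient.mk I s ∉ p := by
  rw [quotLoc, RingHom.comp_apply, IsLocalization.AtPrime.isUnit_to_map_iff _ p]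
  rfl

theorem quotLoc_mem_maximalIdeal_iff {x : S} :
    quotLoc p x ∈ IsLocalRing.maximalIdeal (Localization.AtPrime p) ↔
      Ideal.Quotient.mk I x ∈ p := by
  rw [IsLocalRing.mem_maximalIdeal, mem_nonunits_iff, isUnit_quotLoc_iff, not_not]

theorem exists_mul_quotLoc_eq (y : Localization.AtPrime p) :
    ∃ x s, Ideal.Quotient.mk I s ∉ p ∧ y * quotLoc p s = quotLoc p x := by
  obtain ⟨⟨a, ⟨m, hm⟩⟩, h⟩ := IsLocalization.surj p.primeCompl y
  obtain ⟨x, rfl⟩ := Ideal.Quotient.mk_surjective a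
  obtain ⟨s, rfl⟩ := Ideal.Quotient.mk_surjective m
  exact ⟨x, s, hm, h⟩

theorem isSMulRegular_quotLoc {a : S}
    (h : ∀ x, a * x ∈ I → ∃ s, Ideal.Quotient.mk I s ∉ p ∧ s * x ∈ I) :
    IsSMulRegular (Localization.AtPrime p) (quotLoc p a) := by
  refine (isSMulRegular_iff_right_eq_zero_of_smul (R := Localization.AtPrime p)
    (M := Localization.AtPrime p)).2 fun y hy => ?_
  obtain ⟨x, s, hs, hxs⟩ := exists_mul_quotLoc_eq p y
  have hax : quotLoc p (a * x) = 0 := by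
    rw [map_mul, ← hxs, ← mul_assoc, ← smul_eq_mul (quotLoc p a), hy, zero_mul]
  obtain ⟨t, ht, htx⟩ := (quotLoc_eq_zero_iff p).1 hax
  obtain ⟨w, hw, hwx⟩ := h (t * x) (by rwa [mul_left_comm])
  have hx : quotLoc p x = 0 := by
    refine (quotLoc_eq_zero_iff p).2 ⟨w * t, ?_, by rwa [mul_assoc]⟩
    rw [map_mul]
    exact fun hm => ((Ideal.IsPrime.mem_or_mem ‹_› hm).elim hw ht)
  rw [hx] at hxs
  exact ((isUnit_quotLoc_iff p).2 hs).mul_left_eq_zero.1 hxs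

theorem isRegular_quotLoc_pair {a b : S} (ha : Ideal.Quotient.mk I a ∈ p)
    (hb : Ideal.Quotient.mk I b ∈ p)
    (h₁ : ∀ x, a * x ∈ I → ∃ s, Ideal.Quotient.mk I s ∉ p ∧ s * x ∈ I)
    (h₂ : ∀ x y, b * x - a * y ∈ I →
      ∃ s z, Ideal.Quotient.mk I s ∉ p ∧ s * (x - a * z) ∈ I) :
    RingTheory.Sequence.IsRegular (Localization.AtPrime p) [quotLoc p a, quotLoc p b] := by
  rw [IsLocalRing.isRegular_iff_isWeaklyRegular_of_subset_maximalIdeal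
    (by simp [isUnit_quotLoc_iff, ha, hb]),
    RingTheory.Sequence.isWeaklyRegular_cons_iff,
    RingTheory.Sequence.isWeaklyRegular_singleton_iff]
  refine ⟨isSMulRegular_quotLoc p h₁, ?_⟩
  refine (isSMulRegular_quotient_iff_mem_of_smul_mem _ _).2 fun y hy => ?_
  rw [Submodule.mem_smul_pointwise_iff_exists] at hy ⊢
  obtain ⟨c, -, hc⟩ := hy
  obtain ⟨x₀, s, hs, hxs⟩ := exists_mul_quotLoc_eq p y
  obtain ⟨z₀, t, ht, hzt⟩ := exists_mul_quotLoc_eq p c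
  have key : quotLoc p (b * (t * x₀) - a * (s * z₀)) = 0 := by
    simp only [map_sub, map_mul, ← hxs, ← hzt]
    simp only [smul_eq_mul] at hc
    linear_combination -(quotLoc p s * quotLoc p t) * hc
  obtain ⟨w, hw, hwx⟩ := (quotLoc_eq_zero_iff p).1 key
  obtain ⟨v, z, hv, hvz⟩ := h₂ (w * t * x₀) (w * s * z₀) (by convert! hwx using 1; ring)
  have h0 : quotLoc p (w * t * x₀ - a * z) = 0 := (quotLoc_eq_zero_iff p).2 ⟨v, hv, hvz⟩
  have hu : IsUnit (quotLoc p (w * t * s)) := by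
    simp only [map_mul]
    exact (((isUnit_quotLoc_iff p).2 hw).mul ((isUnit_quotLoc_iff p).2 ht)).mul
      ((isUnit_quotLoc_iff p).2 hs)
  obtain ⟨u, hu⟩ := hu
  refine ⟨↑u⁻¹ * quotLoc p z, trivial, ?_⟩
  have h1 : (u : Localization.AtPrime p) * y = quotLoc p a * quotLoc p z := by
    rw [hu]
    simp only [map_sub, map_mul, ← hxs] at h0 ⊢
    linear_combination h0
  rw [smul_eq_mul, mul_left_comm, ← h1, Units.inv_mul_cancel_left]

end LocalAlgebra

/-- A local ring whose maximal ideal is the sum of two nonzero ideals with zero product has depth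
at most one. -/
theorem IsLocalRing.not_isWeaklyRegular_of_mul_eq_bot {L : Type*} [CommRing L] [IsLocalRing L]
    {J K : Ideal L} (hJK : J * K = ⊥) (hsup : J ⊔ K = IsLocalRing.maximalIdeal L)
    (hJ : J ≠ ⊥) (hK : K ≠ ⊥) {r s : L} {l : List L} (hr : r ∈ IsLocalRing.maximalIdeal L)
    (hs : s ∈ IsLocalRing.maximalIdeal L) :
    ¬ RingTheory.Sequence.IsWeaklyRegular L (r :: s :: l) := by
  intro h
  rw [RingTheory.Sequence.isWeaklyRegular_cons_iff,
    RingTheory.Sequence.isWeaklyRegular_cons_iff] at h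
  obtain ⟨h₁, h₂, -⟩ := h
  have hmul : ∀ x ∈ J, ∀ y ∈ K, x * y = 0 := fun x hx y hy => by
    simpa [hJK] using Ideal.mul_mem_mul hx hy
  have hrJ : r ∉ J := fun hr => hK <| (Submodule.eq_bot_iff _).2 fun y hy =>
    (isSMulRegular_iff_right_eq_zero_of_smul.1 h₁) y (hmul r hr y hy)
  have hrK : r ∉ K := fun hr => hJ <| (Submodule.eq_bot_iff _).2 fun y hy =>
    (isSMulRegular_iff_right_eq_zero_of_smul.1 h₁) y (by
      rw [smul_eq_mul, mul_comm]; exact hmul y hy r hr)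
  rw [← hsup] at hr hs
  obtain ⟨a₁, ha₁, b₁, hb₁, rfl⟩ := Submodule.mem_sup.1 hr
  obtain ⟨a₂, ha₂, b₂, hb₂, rfl⟩ := Submodule.mem_sup.1 hs
  have hmem := mem_of_isSMulRegular_quotient_of_smul_mem h₂ (x := a₁) (by
    rw [Submodule.mem_smul_pointwise_iff_exists]
    refine ⟨a₂, trivial, ?_⟩
    simp only [smul_eq_mul]
    linear_combination hmul a₂ ha₂ b₁ hb₁ - hmul a₁ ha₁ b₂ hb₂)
  rw [Submodule.mem_smul_pointwise_iff_exists] at hmem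
  obtain ⟨c, -, hc⟩ := hmem
  rw [smul_eq_mul] at hc
  rcases IsLocalRing.isUnit_or_isUnit_one_sub_self c with hu | hu
  · obtain ⟨u, rfl⟩ := hu
    refine hrJ (J.add_mem ha₁ ?_)
    have : b₁ = (↑u⁻¹ * (1 - ↑u)) * a₁ := by
      have := Units.inv_mul u
      linear_combination (↑u⁻¹ : L) * hc - (b₁ : L) * this
    rw [this]
    exact J.mul_mem_left _ ha₁
  · obtain ⟨u, hu⟩ := hu
    refine hrK (K.add_mem ?_ hb₁)
    have : a₁ = (↑u⁻¹ * c) * b₁ := by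
      have := Units.inv_mul u
      linear_combination -(↑u⁻¹ : L) * hc - (a₁ : L) * this + (↑u⁻¹ : L) * a₁ * hu
    rw [this]
    exact K.mul_mem_left _ hb₁

section Restriction

open MvPolynomial

variable {k : Type*} [Field k] {W : Finset ℕ}

/-- Restriction of a polynomial to the coordinate subspace of `G`: the variables outside `G`
are set to zero. -/
noncomputable def restr (k : Type*) [Field k] (W G : Finset ℕ) :
    MvPolynomial {x // x ∈ W} k →ₐ[k] MvPolynomial {x // x ∈ W} k :=
  aeval fun i => if i.1 ∈ G then X i else 0

theorem restr_X (G : Finset ℕ) (i : {x // x ∈ W}) :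
    restr k W G (X i) = if i.1 ∈ G then X i else 0 := by
  simp [restr]

theorem restr_restr (G H : Finset ℕ) (x : MvPolynomial {x // x ∈ W} k) :
    restr k W G (restr k W H x) = restr k W (G ∩ H) x := by
  have : (restr k W G).comp (restr k W H) = restr k W (G ∩ H) := by
    ext i : 1
    simp only [AlgHom.comp_apply, restr_X, Finset.mem_inter]
    by_cases h : i.1 ∈ H <;> simp [h, restr_X]
  exact congrArg (fun f : _ →ₐ[k] _ => f x) this

theorem restr_restr_of_subset {G H : Finset ℕ} (h : G ⊆ H)
    (x : MvPolynomial {x // x ∈ W} k) :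
    restr k W G (restr k W H x) = restr k W G x := by
  rw [restr_restr, Finset.inter_eq_left.2 h]

theorem restr_restr_of_superset {G H : Finset ℕ} (h : G ⊆ H)
    (x : MvPolynomial {x // x ∈ W} k) :
    restr k W H (restr k W G x) = restr k W G x := by
  rw [restr_restr, Finset.inter_eq_right.2 h]

theorem coeff_restr (G : Finset ℕ) (x : MvPolynomial {x // x ∈ W} k)
    (m : {x // x ∈ W} →₀ ℕ) (hm : ∀ i ∈ m.support, i.1 ∈ G) :
    coeff m (restr k W G x) = coeff m x := by
  induction x using MvPolynomial.induction_on' with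
  | monomial u a =>
    by_cases hu : ∀ i ∈ u.support, i.1 ∈ G
    · congr 1
      rw [monomial_eq, map_mul, Finsupp.prod, map_prod]
      congr 1
      · simp [restr]
      · refine Finset.prod_congr rfl fun i hi => ?_
        rw [map_pow, restr_X, if_pos (hu i hi)]
    · have h1 : restr k W G (monomial u a) = 0 := by
        push Not at hu
        obtain ⟨i, hi, hiG⟩ := hu
        rw [monomial_eq, map_mul, Finsupp.prod, map_prod, Finset.prod_eq_zero hi, mul_zero]
        rw [map_pow, restr_X, if_neg hiG, zero_pow (Finsupp.mem_support_iff.1 hi)]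
      rw [h1, coeff_zero, coeff_monomial, if_neg]
      rintro rfl
      exact hu hm
  | add p q hp hq => rw [map_add, coeff_add, coeff_add, hp, hq]

theorem sub_restr_mem_span (G : Finset ℕ) (x : MvPolynomial {x // x ∈ W} k) :
    x - restr k W G x ∈ Ideal.span {y | ∃ i : {x // x ∈ W}, i.1 ∉ G ∧ y = X i} := by
  set J := Ideal.span {y : MvPolynomial {x // x ∈ W} k | ∃ i : {x // x ∈ W}, i.1 ∉ G ∧ y = X i}
  have : (Ideal.Quotient.mkₐ k J).comp (restr k W G) = Ideal.Quotient.mkₐ k J := by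
    ext i : 1
    rw [AlgHom.comp_apply, restr_X]
    split_ifs with h
    · rfl
    · rw [map_zero, eq_comm]
      exact Ideal.Quotient.eq_zero_iff_mem.2 (Ideal.subset_span ⟨i, h, rfl⟩)
  rw [← Ideal.Quotient.eq]
  exact (congrArg (fun f : _ →ₐ[k] _ => f x) this).symm

/-- Polynomials on coordinate subspaces which agree on intersections glue. -/
theorem exists_restr_eq (𝒢 : Finset (Finset ℕ)) (u : Finset ℕ → MvPolynomial {x // x ∈ W} k)
    (hu : ∀ G ∈ 𝒢, restr k W G (u G) = u G)
    (hc : ∀ G ∈ 𝒢, ∀ H ∈ 𝒢, restr k W (G ∩ H) (u G) = restr k W (G ∩ H) (u H)) :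
    ∃ z, ∀ G ∈ 𝒢, restr k W G z = u G := by
  classical
  induction 𝒢 using Finset.induction_on with
  | empty => exact ⟨0, by simp⟩
  | insert H 𝒢 _ ih =>
    obtain ⟨z, hz⟩ := ih (fun G hG => hu G (Finset.mem_insert_of_mem hG))
      (fun G hG G' hG' => hc G (Finset.mem_insert_of_mem hG) G' (Finset.mem_insert_of_mem hG'))
    have hH := hu H (Finset.mem_insert_self H 𝒢)
    refine ⟨z + u H - restr k W H z, fun G hG => ?_⟩
    rcases Finset.mem_insert.1 hG with rfl | hG'
    · rw [map_sub, map_add, restr_restr_of_subset subset_rfl, hH]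
      ring
    · have h1 : restr k W G (u H) = restr k W (G ∩ H) (u H) := by
        rw [← restr_restr, hH]
      rw [map_sub, map_add, hz G hG', restr_restr, h1,
        ← hc G hG H (Finset.mem_insert_self H 𝒢), ← hz G hG',
        restr_restr_of_subset Finset.inter_subset_left]
      ring

theorem restr_monoW {F G : Finset ℕ} (hFG : F ⊆ G) :
    restr k W G (monoW k W F) = monoW k W F := by
  rw [monoW, map_prod]
  refine Finset.prod_congr rfl fun i hi => ?_
  rw [restr_X, if_pos (hFG (Finset.mem_subtype.1 hi))]

theorem restr_monoW_of_not_subset {F G : Finset ℕ} (hFW : F ⊆ W) (hFG : ¬ F ⊆ G) :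
    restr k W G (monoW k W F) = 0 := by
  obtain ⟨i, hiF, hiG⟩ := Finset.not_subset.1 hFG
  rw [monoW, map_prod]
  refine Finset.prod_eq_zero (i := ⟨i, hFW hiF⟩) (Finset.mem_subtype.2 hiF) ?_
  rw [restr_X, if_neg hiG]

theorem mem_srIdealW_iff {Δ : SComplex ℕ}
    {x : MvPolynomial {x // x ∈ W} k} :
    x ∈ srIdealW k W Δ ↔ ∀ G ∈ Δ.faces, restr k W G x = 0 := by
  constructor
  · intro hx G hG
    have hle : srIdealW k W Δ ≤ RingHom.ker (restr k W G) := by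
      refine Ideal.span_le.2 ?_
      rintro _ ⟨F, hFW, hF, rfl⟩
      exact restr_monoW_of_not_subset hFW fun h => hF (Δ.down_closed hG h)
    exact hle hx
  · intro h
    rw [← MvPolynomial.support_sum_monomial_coeff x]
    refine Ideal.sum_mem _ fun m hm => ?_
    have hT : m.support.map (Function.Embedding.subtype _) ∉ Δ.faces := fun hT => by
      have h1 := coeff_restr (m.support.map (Function.Embedding.subtype _)) x m
        fun i hi => Finset.mem_map_of_mem _ hi
      rw [h _ hT, coeff_zero] at h1
      exact (MvPolynomial.mem_support_iff.1 hm) h1.symm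
    rw [monomial_eq]
    refine Ideal.mul_mem_left _ _ (Ideal.mem_of_dvd _ ?_ (Ideal.subset_span
      ⟨_, fun i hi => Finset.property_of_mem_map_subtype _ hi, hT, rfl⟩))
    have : (m.support.map (Function.Embedding.subtype _)).subtype (· ∈ W) = m.support := by
      ext i; simp
    rw [monoW, this, Finsupp.prod]
    exact Finset.prod_dvd_prod_of_dvd _ _ fun i hi =>
      dvd_pow_self _ (Finsupp.mem_support_iff.1 hi)

/-- The sum of the variables outside `F`. -/
noncomputable def outerSum (k : Type*) [Field k] (W F : Finset ℕ) :
    MvPolynomial {x // x ∈ W} k :=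
  ∑ i with i.1 ∉ F, X i

/-- The sum of the products of two distinct variables outside `F`. -/
noncomputable def outerPairSum (k : Type*) [Field k] (W F : Finset ℕ) :
    MvPolynomial {x // x ∈ W} k :=
  ∑ T ∈ Finset.powersetCard 2 ({i | i.1 ∉ F} : Finset {x // x ∈ W}), ∏ i ∈ T, X i

theorem restr_outerSum (F G : Finset ℕ) :
    restr k W G (outerSum k W F) = ∑ i with i.1 ∈ G \ F, X i := by
  rw [outerSum, map_sum]
  simp only [restr_X]
  rw [← Finset.sum_filter, Finset.filter_filter]
  refine Finset.sum_congr (Finset.filter_congr fun i _ => ?_) fun _ _ => rfl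
  rw [Finset.mem_sdiff, and_comm]

theorem restr_outerSum_self (F : Finset ℕ) : restr k W F (outerSum k W F) = 0 := by
  simp [restr_outerSum]

theorem restr_outerPairSum_self (F : Finset ℕ) : restr k W F (outerPairSum k W F) = 0 := by
  rw [outerPairSum, map_sum]
  refine Finset.sum_eq_zero fun T hT => ?_
  rw [Finset.mem_powersetCard] at hT
  obtain ⟨i, hi⟩ := Finset.card_pos.1 (hT.2 ▸ Nat.two_pos)
  rw [map_prod]
  refine Finset.prod_eq_zero hi ?_
  rw [restr_X, if_neg (Finset.mem_filter.1 (hT.1 hi)).2]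

theorem prime_restr_outerSum {F G : Finset ℕ} (hG : G ⊆ W) (h : ¬ G ⊆ F) :
    Prime (restr k W G (outerSum k W F)) := by
  classical
  obtain ⟨v, hvG, hvF⟩ := Finset.not_subset.1 h
  let c : {x // x ∈ W} →₀ k := Finsupp.equivFunOnFinite.symm
    fun i => if i.1 ∈ G \ F then 1 else 0
  have hv : c ⟨v, hG hvG⟩ = 1 := by simp [c, hvG, hvF]
  have hc : sumSMulX c = restr k W G (outerSum k W F) := by
    rw [restr_outerSum, sumSMulX, Finsupp.linearCombination_apply,
      Finsupp.sum_fintype _ _ (by simp), Finset.sum_filter]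
    refine Finset.sum_congr rfl fun i _ => ?_
    simp only [c, Finsupp.equivFunOnFinite_symm_apply_apply]
    split_ifs <;> simp
  rw [← hc]
  refine (irreducible_sumSMulX c ⟨⟨v, hG hvG⟩, ?_⟩ fun r hr => ?_).prime
  · simp [hv]
  · exact isUnit_of_dvd_one (hv ▸ hr ⟨v, hG hvG⟩)

theorem not_restr_outerSum_dvd_restr_outerPairSum {F G : Finset ℕ} (hG : G ⊆ W) {v w : ℕ}
    (hv : v ∈ G \ F) (hw : w ∈ G \ F) (hvw : v ≠ w) :
    ¬ restr k W G (outerSum k W F) ∣ restr k W G (outerPairSum k W F) := by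
  classical
  rw [Finset.mem_sdiff] at hv hw
  let v' : {x // x ∈ W} := ⟨v, hG hv.1⟩
  let w' : {x // x ∈ W} := ⟨w, hG hw.1⟩
  have hvw' : v' ≠ w' := fun h => hvw (congrArg Subtype.val h)
  let y : {x // x ∈ W} → k := fun i => if i = v' then 1 else if i = w' then -1 else 0
  have hyv : y v' = 1 := by simp [y]
  have hyw : y w' = -1 := by simp [y, hvw'.symm]
  have hy0 : ∀ i, i ≠ v' → i ≠ w' → y i = 0 := fun i h1 h2 => by simp [y, h1, h2]
  rintro ⟨q, hq⟩
  have hq := congrArg (eval y) hq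
  have hcomp : ∀ z, eval y (restr k W G z) = eval y z := fun z => by
    have : (aeval y).comp (restr k W G) = (aeval y : _ →ₐ[k] k) := by
      ext i : 1
      rw [AlgHom.comp_apply, restr_X]
      split_ifs with h
      · rfl
      · rw [map_zero, aeval_X, hy0 i (fun h' => h (h' ▸ hv.1)) (fun h' => h (h' ▸ hw.1))]
    have := congrArg (fun f : _ →ₐ[k] k => f z) this
    simpa [aeval_eq_eval] using this
  rw [map_mul, hcomp, hcomp] at hq
  have h1 : eval y (outerSum k W F) = 0 := by
    rw [outerSum, map_sum]
    simp only [eval_X]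
    have hs : ({v', w'} : Finset {x // x ∈ W}) ⊆ Finset.univ.filter (fun i => i.1 ∉ F) := by
      intro i hi
      rcases Finset.mem_insert.1 hi with rfl | hi
      · simp [v', hv.2]
      · rw [Finset.mem_singleton.1 hi]; simp [w', hw.2]
    rw [← Finset.sum_subset hs fun i _ hi => hy0 i (fun h => hi (by simp [h]))
      fun h => hi (by simp [h]), Finset.sum_pair hvw', hyv, hyw]
    ring
  have h2 : eval y (outerPairSum k W F) = -1 := by
    rw [outerPairSum, map_sum, Finset.sum_eq_single {v', w'}]
    · rw [map_prod, Finset.prod_pair hvw', eval_X, eval_X, hyv, hyw]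
      ring
    · intro T hT hne
      rw [Finset.mem_powersetCard] at hT
      have : ¬ T ⊆ {v', w'} := fun hsub => hne <| Finset.eq_of_subset_of_card_le hsub <| by
        rw [hT.2, Finset.card_pair hvw']
      obtain ⟨i, hiT, hi⟩ := Finset.not_subset.1 this
      rw [map_prod]
      refine Finset.prod_eq_zero hiT ?_
      rw [eval_X]
      exact hy0 i (fun h => hi (by simp [h])) fun h => hi (by simp [h])
    · intro hT
      refine absurd (Finset.mem_powersetCard.2 ⟨?_, Finset.card_pair hvw'⟩) hT
      intro i hi
      rcases Finset.mem_insert.1 hi with rfl | hi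
      · simp [v', hv.2]
      · rw [Finset.mem_singleton.1 hi]; simp [w', hw.2]
  rw [h1, h2, zero_mul] at hq
  exact one_ne_zero (neg_eq_zero.1 hq)

theorem not_dvd_restr_outerSum {F G : Finset ℕ} (hG : G ⊆ W) (h : ¬ G ⊆ F)
    {f : MvPolynomial {x // x ∈ W} k} (hf : restr k W F f = f) (hu : ¬ IsUnit f) :
    ¬ f ∣ restr k W G (outerSum k W F) := by
  classical
  obtain ⟨v, hvG, hvF⟩ := Finset.not_subset.1 h
  let φ : MvPolynomial {x // x ∈ W} k →ₐ[k] MvPolynomial {x // x ∈ W} k :=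
    aeval fun i => if i.1 ∈ F then X i else if i.1 = v then 1 else 0
  have hφ : φ.comp (restr k W F) = restr k W F := by
    ext i : 1
    rw [AlgHom.comp_apply, restr_X]
    split_ifs with hi
    · simp [φ, hi]
    · simp
  have hφf : φ f = f := by
    have := congrArg (fun g : _ →ₐ[k] _ => g f) hφ
    simpa [hf] using this
  intro hdvd
  have h1 := map_dvd φ hdvd
  rw [hφf, restr_outerSum, map_sum, Finset.sum_eq_single ⟨v, hG hvG⟩] at h1
  · simp only [φ, aeval_X, if_neg hvF, if_true] at h1
    exact hu (isUnit_of_dvd_one h1)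
  · intro i hi hiv
    rw [Finset.mem_filter, Finset.mem_sdiff] at hi
    have : i.1 ≠ v := fun h => hiv (Subtype.ext h)
    simp [φ, hi.2.2, this]
  · intro hi
    simp [hvG, hvF] at hi

/-- A prime ideal avoiding the variables of `F` and containing a nonzero polynomial in these
variables contains a prime polynomial in these variables. -/
theorem exists_prime_mem_restr_eq (P : Ideal (MvPolynomial {x // x ∈ W} k)) [P.IsPrime]
    {F : Finset ℕ} {g : MvPolynomial {x // x ∈ W} k} (hg : restr k W F g ≠ 0)
    (hgP : restr k W F g ∈ P) : ∃ f ∈ P, Prime f ∧ restr k W F f = f := by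
  classical
  let s : Set {x // x ∈ W} := {i | i.1 ∈ F}
  let ι : MvPolynomial s k →ₐ[k] MvPolynomial {x // x ∈ W} k := rename Subtype.val
  have hι : (restr k W F).comp ι = ι := by
    ext i : 1
    simp [ι, restr_X, show i.1.1 ∈ F from i.2]
  let π : MvPolynomial {x // x ∈ W} k →ₐ[k] MvPolynomial s k :=
    aeval fun i => if h : i.1 ∈ F then X ⟨i, h⟩ else 0
  have hπ : ι.comp π = restr k W F := by
    ext i : 1
    rw [AlgHom.comp_apply, restr_X]
    by_cases h : i.1 ∈ F <;> simp [π, ι, h]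
  have hπg : ι (π g) = restr k W F g := congrArg (fun f : _ →ₐ[k] _ => f g) hπ
  have hne : P.comap ι ≠ ⊥ := fun h => by
    have : π g ∈ P.comap ι := by rw [Ideal.mem_comap, hπg]; exact hgP
    rw [h, Ideal.mem_bot] at this
    rw [← hπg, this, map_zero] at hg
    exact hg rfl
  obtain ⟨f, hf, hfp⟩ := Ideal.IsPrime.exists_mem_prime_of_ne_bot
    (inferInstance : (P.comap ι).IsPrime) hne
  exact ⟨ι f, hf, (prime_rename_iff s).2 hfp, congrArg (fun g : _ →ₐ[k] _ => g f) hι⟩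

end Restriction

section LocalDimension

variable {S : Type*} [CommRing S] {I : Ideal S} (p : Ideal (S ⧸ I)) [p.IsPrime]

theorem maximalIdeal_le_of_quotLoc_mem {q : Ideal (Localization.AtPrime p)}
    (h : ∀ x, Ideal.Quotient.mk I x ∈ p → quotLoc p x ∈ q) :
    IsLocalRing.maximalIdeal (Localization.AtPrime p) ≤ q := by
  intro y hy
  obtain ⟨x, s, hs, hxs⟩ := exists_mul_quotLoc_eq p y
  have hx : quotLoc p x ∈ q := by
    refine h x ((quotLoc_mem_maximalIdeal_iff p).1 ?_)
    rw [← hxs]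
    exact Ideal.mul_mem_right _ _ hy
  rw [← hxs] at hx
  exact (Ideal.mul_unit_mem_iff_mem _ ((isUnit_quotLoc_iff p).2 hs)).1 hx

theorem ringKrullDim_le_one_of_quotLoc [IsNoetherianRing S] {a : S}
    (ha : Ideal.Quotient.mk I a ∈ p)
    (h : ∀ q : Ideal (Localization.AtPrime p), q.IsPrime → quotLoc p a ∈ q →
      ∀ x, Ideal.Quotient.mk I x ∈ p → quotLoc p x ∈ q) :
    ringKrullDim (Localization.AtPrime p) ≤ 1 := by
  have : IsNoetherianRing (Localization.AtPrime p) :=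
    IsLocalization.isNoetherianRing p.primeCompl _ inferInstance
  rw [← IsLocalRing.maximalIdeal_height_eq_ringKrullDim]
  refine WithBot.coe_le_coe.2 (Ideal.height_le_one_of_isPrincipal_of_mem_minimalPrimes
    (Ideal.span {quotLoc p a}) _ ⟨⟨inferInstance, ?_⟩, ?_⟩)
  · rw [Ideal.span_singleton_le_iff_mem, quotLoc_mem_maximalIdeal_iff]
    exact ha
  · rintro q ⟨hq, haq⟩ -
    exact maximalIdeal_le_of_quotLoc_mem p (h q hq ((Ideal.span_singleton_le_iff_mem q).1 haq))

theorem isRegular_quotLoc_singleton {a : S} (ha : Ideal.Quotient.mk I a ∈ p)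
    (h : ∀ x, a * x ∈ I → ∃ s, Ideal.Quotient.mk I s ∉ p ∧ s * x ∈ I) :
    RingTheory.Sequence.IsRegular (Localization.AtPrime p) [quotLoc p a] := by
  rw [IsLocalRing.isRegular_iff_isWeaklyRegular_of_subset_maximalIdeal
    (by simp [isUnit_quotLoc_iff, ha]), RingTheory.Sequence.isWeaklyRegular_singleton_iff]
  exact isSMulRegular_quotLoc p h

end LocalDimension

section StanleyReisner

open MvPolynomial

variable {k : Type*} [Field k] {W : Finset ℕ} {Δ : SComplex ℕ} {d : ℕ}

theorem monoW_mul_mem_srIdealW (hW : ∀ F ∈ Δ.faces, F ⊆ W)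
    (hext : ∀ F ∈ Δ.faces, ∃ G ∈ Δ.faces, F ⊆ G ∧ G.card = d)
    {F : Finset ℕ} (hF : F ∈ Δ.faces) {x : MvPolynomial {x // x ∈ W} k}
    (hx : ∀ G ∈ Δ.faces, F ⊆ G → G.card = d → restr k W G x = 0) :
    monoW k W F * x ∈ srIdealW k W Δ := by
  rw [mem_srIdealW_iff]
  intro G hG
  rw [map_mul]
  by_cases hFG : F ⊆ G
  · obtain ⟨H, hH, hGH, hcard⟩ := hext G hG
    rw [← restr_restr_of_subset hGH, ← restr_restr_of_subset hGH x,
      hx H hH (hFG.trans hGH) hcard, map_zero, mul_zero]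
  · rw [restr_monoW_of_not_subset (hW F hF) hFG, zero_mul]

/-- If `a` is prime on every facet through `F`, it is regular locally. -/
theorem exists_mul_mem_srIdealW_of_prime (hW : ∀ F ∈ Δ.faces, F ⊆ W)
    (hext : ∀ F ∈ Δ.faces, ∃ G ∈ Δ.faces, F ⊆ G ∧ G.card = d)
    {p : Ideal (srRingW k W Δ)} {F : Finset ℕ} (hF : F ∈ Δ.faces)
    (hFp : Ideal.Quotient.mk (srIdealW k W Δ) (monoW k W F) ∉ p)
    {a : MvPolynomial {x // x ∈ W} k}
    (ha : ∀ G ∈ Δ.faces, F ⊆ G → G.card = d → Prime (restr k W G a))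
    (x : MvPolynomial {x // x ∈ W} k) (hx : a * x ∈ srIdealW k W Δ) :
    ∃ s, Ideal.Quotient.mk (srIdealW k W Δ) s ∉ p ∧ s * x ∈ srIdealW k W Δ := by
  refine ⟨_, hFp, monoW_mul_mem_srIdealW hW hext hF fun G hG hFG hc => ?_⟩
  have := mem_srIdealW_iff.1 hx G hG
  rw [map_mul] at this
  exact (mul_eq_zero.1 this).resolve_left (ha G hG hFG hc).ne_zero

theorem isRegular_pair_of_prime_restr (hW : ∀ F ∈ Δ.faces, F ⊆ W)
    (hext : ∀ F ∈ Δ.faces, ∃ G ∈ Δ.faces, F ⊆ G ∧ G.card = d)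
    {p : Ideal (srRingW k W Δ)} [p.IsPrime] {F : Finset ℕ} (hF : F ∈ Δ.faces)
    (hFp : Ideal.Quotient.mk (srIdealW k W Δ) (monoW k W F) ∉ p)
    {a b : MvPolynomial {x // x ∈ W} k}
    (hap : Ideal.Quotient.mk (srIdealW k W Δ) a ∈ p)
    (hbp : Ideal.Quotient.mk (srIdealW k W Δ) b ∈ p)
    (ha : ∀ G ∈ Δ.faces, F ⊆ G → G.card = d → Prime (restr k W G a))
    (hab : ∀ G ∈ Δ.faces, F ⊆ G → G.card = d → ¬ restr k W G a ∣ restr k W G b)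
    (hglue : ∀ u : Finset ℕ → MvPolynomial {x // x ∈ W} k,
      (∀ G ∈ Δ.faces, F ⊆ G → G.card = d → ∀ H ∈ Δ.faces, F ⊆ H → H.card = d →
        restr k W (G ∩ H) a ≠ 0 → restr k W (G ∩ H) (u G) = restr k W (G ∩ H) (u H)) →
      ∀ G ∈ Δ.faces, F ⊆ G → G.card = d → ∀ H ∈ Δ.faces, F ⊆ H → H.card = d →
        restr k W (G ∩ H) a = 0 → restr k W (G ∩ H) (u G) = restr k W (G ∩ H) (u H)) :
    RingTheory.Sequence.IsRegular (Localization.AtPrime p) [quotLoc p a, quotLoc p b] := by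
  classical
  refine isRegular_quotLoc_pair p hap hbp
    (exists_mul_mem_srIdealW_of_prime hW hext hF hFp ha) fun x y hxy => ?_
  have hdvd : ∀ G ∈ Δ.faces, F ⊆ G → G.card = d → restr k W G a ∣ restr k W G x := by
    intro G hG hFG hc
    have := mem_srIdealW_iff.1 hxy G hG
    rw [map_sub, map_mul, map_mul, sub_eq_zero] at this
    exact ((ha G hG hFG hc).dvd_or_dvd ⟨_, this⟩).resolve_left (hab G hG hFG hc)
  choose! w hw using hdvd
  let u : Finset ℕ → MvPolynomial {x // x ∈ W} k := fun G => restr k W G (w G)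
  have hxu : ∀ G ∈ Δ.faces, F ⊆ G → G.card = d →
      restr k W G x = restr k W G a * u G := by
    intro G hG hFG hc
    have := congrArg (restr k W G) (hw G hG hFG hc)
    rwa [map_mul, restr_restr_of_subset subset_rfl, restr_restr_of_subset subset_rfl] at this
  have hcompat : ∀ G ∈ Δ.faces, F ⊆ G → G.card = d → ∀ H ∈ Δ.faces, F ⊆ H → H.card = d →
      restr k W (G ∩ H) (u G) = restr k W (G ∩ H) (u H) := by
    have hne : ∀ G ∈ Δ.faces, F ⊆ G → G.card = d → ∀ H ∈ Δ.faces, F ⊆ H → H.card = d →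
        restr k W (G ∩ H) a ≠ 0 → restr k W (G ∩ H) (u G) = restr k W (G ∩ H) (u H) := by
      intro G hG hFG hGc H hH hFH hHc hne
      refine mul_left_cancel₀ hne ?_
      have h1 := congrArg (restr k W (G ∩ H)) (hxu G hG hFG hGc)
      have h2 := congrArg (restr k W (G ∩ H)) (hxu H hH hFH hHc)
      rw [map_mul, restr_restr_of_subset Finset.inter_subset_left,
        restr_restr_of_subset Finset.inter_subset_left] at h1
      rw [map_mul, restr_restr_of_subset Finset.inter_subset_right,
        restr_restr_of_subset Finset.inter_subset_right] at h2
      rw [← h1, ← h2]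
    intro G hG hFG hGc H hH hFH hHc
    by_cases h0 : restr k W (G ∩ H) a = 0
    · exact hglue u hne G hG hFG hGc H hH hFH hHc h0
    · exact hne G hG hFG hGc H hH hFH hHc h0
  obtain ⟨z, hz⟩ := exists_restr_eq
    {G ∈ W.powerset | G ∈ Δ.faces ∧ F ⊆ G ∧ G.card = d} u
    (fun G _ => restr_restr_of_subset subset_rfl _)
    (fun G hG H hH => by
      obtain ⟨-, h1, h2, h3⟩ := Finset.mem_filter.1 hG
      obtain ⟨-, h4, h5, h6⟩ := Finset.mem_filter.1 hH
      exact hcompat G h1 h2 h3 H h4 h5 h6)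
  refine ⟨_, z, hFp, monoW_mul_mem_srIdealW hW hext hF fun G hG hFG hc => ?_⟩
  rw [map_sub, map_mul, hxu G hG hFG hc,
    hz G (Finset.mem_filter.2 ⟨Finset.mem_powerset.2 (hW G hG), hG, hFG, hc⟩), sub_self]

/-- The vertices of the link of `F` are connected by edges of the link. -/
def LinkPreconnected (Δ : SComplex ℕ) (F : Finset ℕ) : Prop :=
  ∀ a b : ℕ, {a} ∈ (Δ.link F).faces → {b} ∈ (Δ.link F).faces →
    Relation.ReflTransGen (fun x y => x ≠ y ∧ ({x, y} : Finset ℕ) ∈ (Δ.link F).faces) a b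

theorem mem_link_of_subset {F G T : Finset ℕ} (hG : G ∈ Δ.faces) (hFG : F ⊆ G)
    (hT : T ⊆ G \ F) : T ∈ (Δ.link F).faces :=
  ⟨Δ.down_closed hG (hT.trans Finset.sdiff_subset),
    Finset.disjoint_left.2 fun _ hx => (Finset.mem_sdiff.1 (hT hx)).2,
    Δ.down_closed hG (Finset.union_subset (hT.trans Finset.sdiff_subset) hFG)⟩

theorem restr_eq_of_linkPreconnected
    (hext : ∀ F ∈ Δ.faces, ∃ G ∈ Δ.faces, F ⊆ G ∧ G.card = d)
    {F : Finset ℕ} (hFd : F.card < d) (hconn : LinkPreconnected Δ F)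
    (u : Finset ℕ → MvPolynomial {x // x ∈ W} k)
    (hu : ∀ G ∈ Δ.faces, F ⊆ G → G.card = d → ∀ H ∈ Δ.faces, F ⊆ H → H.card = d →
      ¬ G ∩ H ⊆ F → restr k W (G ∩ H) (u G) = restr k W (G ∩ H) (u H))
    {G : Finset ℕ} (hG : G ∈ Δ.faces) (hFG : F ⊆ G) (hGc : G.card = d)
    {H : Finset ℕ} (hH : H ∈ Δ.faces) (hFH : F ⊆ H) (hHc : H.card = d) :
    restr k W F (u G) = restr k W F (u H) := by
  have hcommon : ∀ v ∉ F, ∀ G ∈ Δ.faces, F ⊆ G → G.card = d → v ∈ G →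
      ∀ H ∈ Δ.faces, F ⊆ H → H.card = d → v ∈ H → restr k W F (u G) = restr k W F (u H) := by
    intro v hv G hG hFG hGc hvG H hH hFH hHc hvH
    have := congrArg (restr k W F) (hu G hG hFG hGc H hH hFH hHc
      fun h => hv (h (Finset.mem_inter.2 ⟨hvG, hvH⟩)))
    rwa [restr_restr_of_subset (Finset.subset_inter hFG hFH),
      restr_restr_of_subset (Finset.subset_inter hFG hFH)] at this
  have hex : ∀ G : Finset ℕ, G.card = d → ∃ v ∈ G, v ∉ F := fun G hGc =>
    Finset.exists_mem_notMem_of_card_lt_card (hGc ▸ hFd)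
  obtain ⟨a, haG, haF⟩ := hex G hGc
  obtain ⟨b, hbH, hbF⟩ := hex H hHc
  have hab := hconn a b
    (mem_link_of_subset hG hFG (by simp [haG, haF]))
    (mem_link_of_subset hH hFH (by simp [hbH, hbF]))
  clear hex
  induction hab generalizing H with
  | refl => exact hcommon a haF G hG hFG hGc haG H hH hFH hHc hbH
  | tail _ hxy ih =>
    obtain ⟨-, -, hdisj, hmem⟩ := hxy
    obtain ⟨K, hK, hFK, hKc⟩ := hext _ hmem
    rw [Finset.disjoint_left] at hdisj
    rw [ih hK (Finset.subset_union_right.trans hFK) hKc (hFK (by simp)) (hdisj (by simp))]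
    exact hcommon _ hbF K hK (Finset.subset_union_right.trans hFK) hKc (hFK (by simp))
      H hH hFH hHc hbH

/-- The face of variables not contained in a prime of the Stanley–Reisner ring. -/
theorem exists_face_of_isPrime (p : Ideal (srRingW k W Δ)) [p.IsPrime] :
    ∃ F ∈ Δ.faces, Ideal.Quotient.mk (srIdealW k W Δ) (monoW k W F) ∉ p ∧
      ∀ x, restr k W F x = 0 → Ideal.Quotient.mk (srIdealW k W Δ) x ∈ p := by
  classical
  let F : Finset ℕ := {i : {x // x ∈ W} | Ideal.Quotient.mk (srIdealW k W Δ) (X i) ∉ p}.toFinset.map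
    (Function.Embedding.subtype _)
  have hmem : ∀ i : {x // x ∈ W},
      i.1 ∈ F ↔ Ideal.Quotient.mk (srIdealW k W Δ) (X i) ∉ p := fun i => by simp [F]
  have hFp : Ideal.Quotient.mk (srIdealW k W Δ) (monoW k W F) ∉ p := by
    rw [monoW, map_prod, Ideal.IsPrime.prod_mem_iff]
    rintro ⟨i, hi, h⟩
    exact (hmem i).1 (Finset.mem_subtype.1 hi) h
  refine ⟨F, ?_, hFp, fun x hx => ?_⟩
  · by_contra hF
    refine hFp ?_
    have h : monoW k W F ∈ srIdealW k W Δ :=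
      Ideal.subset_span ⟨F, fun i hi => Finset.property_of_mem_map_subtype _ hi, hF, rfl⟩
    rw [Ideal.Quotient.eq_zero_iff_mem.2 h]
    exact p.zero_mem
  · have h := sub_restr_mem_span F x
    rw [hx, sub_zero] at h
    have hle : Ideal.span {y | ∃ i : {x // x ∈ W}, i.1 ∉ F ∧ y = X i} ≤
        p.comap (Ideal.Quotient.mk (srIdealW k W Δ)) := by
      refine Ideal.span_le.2 ?_
      rintro _ ⟨i, hi, rfl⟩
      exact not_not.1 (mt (hmem i).2 hi)
    exact hle h

theorem ringKrullDim_le_one_of_card_add_one (hW : ∀ F ∈ Δ.faces, F ⊆ W)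
    (hext : ∀ F ∈ Δ.faces, ∃ G ∈ Δ.faces, F ⊆ G ∧ G.card = d)
    {p : Ideal (srRingW k W Δ)} [p.IsPrime] {F : Finset ℕ} (hF : F ∈ Δ.faces)
    (hFp : Ideal.Quotient.mk (srIdealW k W Δ) (monoW k W F) ∉ p)
    (hp : ∀ x, Ideal.Quotient.mk (srIdealW k W Δ) x ∈ p ↔ restr k W F x = 0)
    (hFd : F.card + 1 = d) : ringKrullDim (Localization.AtPrime p) ≤ 1 := by
  refine ringKrullDim_le_one_of_quotLoc p ((hp _).2 (restr_outerSum_self F))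
    fun q hq hθ x hx => ?_
  have h := sub_restr_mem_span F x
  rw [(hp x).1 hx, sub_zero] at h
  have hle : Ideal.span {y | ∃ i : {x // x ∈ W}, i.1 ∉ F ∧ y = X i} ≤ q.comap (quotLoc p) := by
    refine Ideal.span_le.2 ?_
    rintro _ ⟨i, hi, rfl⟩
    have h0 : quotLoc p (X i * (X i - outerSum k W F)) = 0 := by
      refine (quotLoc_eq_zero_iff p).2
        ⟨_, hFp, monoW_mul_mem_srIdealW hW hext hF fun G hG hFG hc => ?_⟩
      rw [map_mul, map_sub, restr_X]
      split_ifs with hiG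
      · have hGF : G \ F = {i.1} := by
          refine (Finset.eq_of_subset_of_card_le (by simp [hi, hiG]) ?_).symm
          rw [Finset.card_sdiff_of_subset hFG, Finset.card_singleton]
          omega
        rw [restr_outerSum, hGF]
        have : (Finset.univ.filter fun j : {x // x ∈ W} => j.1 ∈ ({i.1} : Finset ℕ)) = {i} := by
          ext j
          rw [Finset.mem_filter, Finset.mem_singleton, Finset.mem_singleton, Subtype.val_inj]
          simp
        rw [this, Finset.sum_singleton, sub_self, mul_zero]
      · rw [zero_mul]
    have h1 : quotLoc p (X i) * quotLoc p (X i) = quotLoc p (X i) * quotLoc p (outerSum k W F) := by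
      rw [mul_sub, map_sub, sub_eq_zero, map_mul, map_mul] at h0
      exact h0
    have h2 : quotLoc p (X i) * quotLoc p (X i) ∈ q := h1 ▸ q.mul_mem_left _ hθ
    exact (hq.mem_or_mem h2).elim id id
  exact hle h

theorem ringSerreS2_of_linkPreconnected (hW : ∀ F ∈ Δ.faces, F ⊆ W)
    (hle : ∀ F ∈ Δ.faces, F.card ≤ d)
    (hext : ∀ F ∈ Δ.faces, ∃ G ∈ Δ.faces, F ⊆ G ∧ G.card = d)
    (hconn : ∀ F ∈ Δ.faces, F.card + 2 ≤ d → LinkPreconnected Δ F) :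
    RingSerreS2 (srRingW k W Δ) := by
  intro p _
  obtain ⟨F, hF, hFp, hpF⟩ := exists_face_of_isPrime p
  have hpθ := hpF _ (restr_outerSum_self F)
  have hnotsub : F.card < d → ∀ G : Finset ℕ, G.card = d → ¬ G ⊆ F := fun hFd G hGc h =>
    absurd (Finset.card_le_card h) (by omega)
  have heq : F.card = d → ∀ G : Finset ℕ, F ⊆ G → G.card = d → G = F := fun hFd G h hGc =>
    (Finset.eq_of_subset_of_card_le h (by omega)).symm
  by_cases hQ : ∀ x, Ideal.Quotient.mk (srIdealW k W Δ) x ∈ p → restr k W F x = 0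
  · have hp : ∀ x, Ideal.Quotient.mk (srIdealW k W Δ) x ∈ p ↔ restr k W F x = 0 :=
      fun x => ⟨hQ x, hpF x⟩
    rcases (hle F hF).eq_or_lt with hFd | hFd
    · refine ⟨[], by simp, RingTheory.Sequence.IsRegular.nil _ _, (min_le_right _ _).trans ?_⟩
      refine (ringKrullDim_eq_zero_of_isField (IsLocalRing.isField_iff_maximalIdeal_eq.2 ?_)).le
      refine le_bot_iff.1 (maximalIdeal_le_of_quotLoc_mem p fun x hx => ?_)
      refine (quotLoc_eq_zero_iff p).2
        ⟨_, hFp, monoW_mul_mem_srIdealW hW hext hF fun G _ hFG hc => ?_⟩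
      rw [heq hFd G hFG hc, hQ x hx]
    have hprime : ∀ G ∈ Δ.faces, F ⊆ G → G.card = d → Prime (restr k W G (outerSum k W F)) :=
      fun G hG _ hc => prime_restr_outerSum (hW G hG) (hnotsub hFd G hc)
    rcases (Nat.succ_le_of_lt hFd).eq_or_lt with hFd' | hFd'
    · refine ⟨[quotLoc p (outerSum k W F)], ?_, isRegular_quotLoc_singleton p hpθ
        (exists_mul_mem_srIdealW_of_prime hW hext hF hFp hprime), (min_le_right _ _).trans ?_⟩
      · simp [isUnit_quotLoc_iff, hpθ]
      · exact ringKrullDim_le_one_of_card_add_one hW hext hF hFp hp hFd'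
    · have hpθ₂ := hpF _ (restr_outerPairSum_self F)
      refine ⟨[quotLoc p (outerSum k W F), quotLoc p (outerPairSum k W F)], ?_,
        isRegular_pair_of_prime_restr hW hext hF hFp hpθ hpθ₂ hprime ?_ ?_, min_le_left _ _⟩
      · simp [isUnit_quotLoc_iff, hpθ, hpθ₂]
      · intro G hG hFG hc
        obtain ⟨v, hv, w, hw, hvw⟩ := Finset.one_lt_card.1
          (show 1 < (G \ F).card by rw [Finset.card_sdiff_of_subset hFG]; omega)
        exact not_restr_outerSum_dvd_restr_outerPairSum (hW G hG) hv hw hvw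
      · intro u hu G hG hFG hGc H hH hFH hHc h0
        have hprime' : ∀ G ∈ Δ.faces, ∀ H : Finset ℕ, ¬ G ∩ H ⊆ F →
            restr k W (G ∩ H) (outerSum k W F) ≠ 0 := fun G hG H h =>
          (prime_restr_outerSum (Finset.inter_subset_left.trans (hW G hG)) h).ne_zero
        have hGH : G ∩ H = F := Finset.Subset.antisymm
          (not_not.1 fun h => hprime' G hG H h h0) (Finset.subset_inter hFG hFH)
        rw [hGH]
        exact restr_eq_of_linkPreconnected hext hFd (hconn F hF hFd') u
          (fun G hG hFG hGc H hH hFH hHc h =>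
            hu G hG hFG hGc H hH hFH hHc (hprime' G hG H h)) hG hFG hGc hH hFH hHc
  · push Not at hQ
    obtain ⟨g, hgp, hg⟩ := hQ
    have hgp' : Ideal.Quotient.mk (srIdealW k W Δ) (restr k W F g) ∈ p := by
      have := hpF (g - restr k W F g)
        (by rw [map_sub, restr_restr_of_subset subset_rfl, sub_self])
      rw [map_sub] at this
      simpa using p.sub_mem hgp this
    obtain ⟨f, hfp, hf, hFf⟩ :=
      exists_prime_mem_restr_eq (p.comap (Ideal.Quotient.mk (srIdealW k W Δ))) hg hgp'
    have hGf : ∀ G, F ⊆ G → restr k W G f = f := fun G hFG => by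
      rw [← hFf, restr_restr_of_superset hFG]
    have hprime : ∀ G ∈ Δ.faces, F ⊆ G → G.card = d → Prime (restr k W G f) :=
      fun G _ hFG _ => by rwa [hGf G hFG]
    have hpair : ∀ b, Ideal.Quotient.mk (srIdealW k W Δ) b ∈ p →
        (∀ G ∈ Δ.faces, F ⊆ G → G.card = d → ¬ f ∣ restr k W G b) →
        RingTheory.Sequence.IsRegular (Localization.AtPrime p) [quotLoc p f, quotLoc p b] := by
      intro b hb hfb
      refine isRegular_pair_of_prime_restr hW hext hF hFp hfp hb hprime
        (fun G hG hFG hc => by rw [hGf G hFG]; exact hfb G hG hFG hc) ?_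
      intro u _ G _ hFG _ H _ hFH _ h0
      rw [hGf _ (Finset.subset_inter hFG hFH)] at h0
      exact absurd h0 hf.ne_zero
    rcases (hle F hF).eq_or_lt with hFd | hFd
    · by_cases hall : ∀ x, Ideal.Quotient.mk (srIdealW k W Δ) x ∈ p → f ∣ restr k W F x
      · refine ⟨[quotLoc p f], ?_, isRegular_quotLoc_singleton p hfp
          (exists_mul_mem_srIdealW_of_prime hW hext hF hFp hprime), (min_le_right _ _).trans ?_⟩
        · simpa [isUnit_quotLoc_iff] using hfp
        · refine ringKrullDim_le_one_of_quotLoc p hfp fun q _ hfq x hx => ?_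
          obtain ⟨z, hz⟩ := hall x hx
          have h0 : quotLoc p (x - f * z) = 0 := by
            refine (quotLoc_eq_zero_iff p).2
              ⟨_, hFp, monoW_mul_mem_srIdealW hW hext hF fun G _ hFG hc => ?_⟩
            have hz' := congrArg (restr k W F) hz
            rw [restr_restr_of_subset subset_rfl] at hz'
            rw [heq hFd G hFG hc, map_sub, hz', sub_self]
          rw [map_sub, map_mul, sub_eq_zero] at h0
          exact h0 ▸ q.mul_mem_right _ hfq
      · push Not at hall
        obtain ⟨b, hb, hfb⟩ := hall
        refine ⟨[quotLoc p f, quotLoc p b], ?_, hpair b hb ?_, min_le_left _ _⟩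
        · simpa [isUnit_quotLoc_iff, hb] using hfp
        · intro G _ hFG hc
          rwa [heq hFd G hFG hc]
    · refine ⟨[quotLoc p f, quotLoc p (outerSum k W F)], ?_, hpair _ hpθ ?_, min_le_left _ _⟩
      · simpa [isUnit_quotLoc_iff, hpθ] using hfp
      · exact fun G hG _ hc =>
          not_dvd_restr_outerSum (hW G hG) (hnotsub hFd G hc) hFf hf.not_isUnit

/-- The prime ideal of the Stanley–Reisner ring of the polynomials vanishing on the coordinate
subspace of a face. -/
noncomputable def facePrime (k : Type*) [Field k] (W : Finset ℕ) {F : Finset ℕ}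
    (hF : F ∈ Δ.faces) : Ideal (srRingW k W Δ) :=
  RingHom.ker (Ideal.Quotient.lift (srIdealW k W Δ) (restr k W F).toRingHom
    fun _ hx => mem_srIdealW_iff.1 hx F hF)

instance isPrime_facePrime {F : Finset ℕ} (hF : F ∈ Δ.faces) : (facePrime k W hF).IsPrime :=
  RingHom.ker_isPrime _

theorem mk_mem_facePrime_iff {F : Finset ℕ} (hF : F ∈ Δ.faces)
    {x : MvPolynomial {x // x ∈ W} k} :
    Ideal.Quotient.mk (srIdealW k W Δ) x ∈ facePrime k W hF ↔ restr k W F x = 0 := Iff.rfl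

theorem facePrime_lt_facePrime (hW : ∀ F ∈ Δ.faces, F ⊆ W) {F G : Finset ℕ}
    (hF : F ∈ Δ.faces) (hG : G ∈ Δ.faces) (hFG : F ⊂ G) :
    facePrime k W hG < facePrime k W hF := by
  obtain ⟨v, hvG, hvF⟩ := Finset.exists_of_ssubset hFG
  refine lt_of_le_of_ne (fun y hy => ?_) fun h => ?_
  · obtain ⟨x, rfl⟩ := Ideal.Quotient.mk_surjective y
    rw [mk_mem_facePrime_iff] at hy ⊢
    rw [← restr_restr_of_subset hFG.subset, hy, map_zero]
  · have h1 : Ideal.Quotient.mk (srIdealW k W Δ) (X ⟨v, hW G hG hvG⟩) ∈ facePrime k W hF := by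
      rw [mk_mem_facePrime_iff, restr_X, if_neg hvF]
    rw [← h, mk_mem_facePrime_iff, restr_X, if_pos hvG] at h1
    exact X_ne_zero _ h1

theorem two_le_ringKrullDim_facePrime (hW : ∀ F ∈ Δ.faces, F ⊆ W)
    (hext : ∀ F ∈ Δ.faces, ∃ G ∈ Δ.faces, F ⊆ G ∧ G.card = d)
    {F : Finset ℕ} (hF : F ∈ Δ.faces) (hFd : F.card + 2 ≤ d) :
    2 ≤ ringKrullDim (Localization.AtPrime (facePrime k W hF)) := by
  obtain ⟨G, hG, hFG, hc⟩ := hext F hF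
  obtain ⟨v, hvG, hvF⟩ := Finset.exists_of_ssubset
    (hFG.ssubset_of_ne fun h => by rw [h] at hFd; omega)
  have hH : insert v F ⊆ G := Finset.insert_subset hvG hFG
  have hHG : insert v F ⊂ G := hH.ssubset_of_ne fun h => by
    have := Finset.card_insert_of_notMem hvF
    rw [h] at this
    omega
  have hHΔ := Δ.down_closed hG hH
  have h1 := Ideal.height_add_one_le_of_lt_of_isPrime
    (facePrime_lt_facePrime (k := k) hW hHΔ hG hHG)
  have h2 := Ideal.height_add_one_le_of_lt_of_isPrime
    (facePrime_lt_facePrime (k := k) hW hF hHΔ (Finset.ssubset_insert hvF))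
  rw [IsLocalization.AtPrime.ringKrullDim_eq_height (facePrime k W hF)
    (Localization.AtPrime (facePrime k W hF))]
  refine WithBot.coe_le_coe.2 (le_trans ?_ h2)
  calc (2 : ℕ∞) = 0 + 1 + 1 := by norm_num
    _ ≤ _ := by gcongr; exact le_trans (by gcongr; exact zero_le) h1

theorem linkPreconnected_of_ringSerreS2 (hW : ∀ F ∈ Δ.faces, F ⊆ W)
    (hext : ∀ F ∈ Δ.faces, ∃ G ∈ Δ.faces, F ⊆ G ∧ G.card = d)
    (hS2 : RingSerreS2 (srRingW k W Δ)) {F : Finset ℕ} (hF : F ∈ Δ.faces)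
    (hFd : F.card + 2 ≤ d) : LinkPreconnected Δ F := by
  intro a b ha hb
  by_contra hab
  set r : ℕ → ℕ → Prop := fun x y => x ≠ y ∧ ({x, y} : Finset ℕ) ∈ (Δ.link F).faces
  set p := facePrime k W hF
  have hFp : Ideal.Quotient.mk (srIdealW k W Δ) (monoW k W F) ∉ p := by
    rw [mk_mem_facePrime_iff, restr_monoW subset_rfl, monoW, Finset.prod_eq_zero_iff]
    rintro ⟨i, -, hi⟩
    exact X_ne_zero i hi
  obtain ⟨rs, hrs, hreg, hlen⟩ := hS2 p
  rw [min_eq_left (two_le_ringKrullDim_facePrime hW hext hF hFd)] at hlen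
  have hlen : 2 ≤ rs.length := by exact_mod_cast hlen
  obtain ⟨r₁, r₂, l, rfl⟩ : ∃ r₁ r₂ l, rs = r₁ :: r₂ :: l := by
    match rs, hlen with
    | r₁ :: r₂ :: l, _ => exact ⟨r₁, r₂, l, rfl⟩
  let A : Set (MvPolynomial {x // x ∈ W} k) :=
    {y | ∃ i : {x // x ∈ W}, (i.1 ∉ F ∧ Relation.ReflTransGen r a i) ∧ y = X i}
  let B : Set (MvPolynomial {x // x ∈ W} k) :=
    {y | ∃ i : {x // x ∈ W}, (i.1 ∉ F ∧ ¬ Relation.ReflTransGen r a i) ∧ y = X i}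
  have hne : ∀ v, {v} ∈ (Δ.link F).faces → ∀ hv : v ∈ W, quotLoc p (X ⟨v, hv⟩) ≠ 0 := by
    rintro v ⟨-, -, hvF⟩ hv h0
    obtain ⟨s, hs, hsx⟩ := (quotLoc_eq_zero_iff p).1 h0
    have h1 := mem_srIdealW_iff.1 hsx _ hvF
    rw [map_mul, restr_X, if_pos (by simp)] at h1
    refine hs ((mk_mem_facePrime_iff hF).2 ?_)
    rw [← restr_restr_of_subset (Finset.subset_union_right (s₁ := {v})),
      (mul_eq_zero.1 h1).resolve_right (X_ne_zero _), map_zero]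
  have hvertex : ∀ v, {v} ∈ (Δ.link F).faces → v ∈ W ∧ v ∉ F := fun v hv =>
    ⟨hW _ hv.1 (by simp), by simpa using hv.2.1⟩
  refine IsLocalRing.not_isWeaklyRegular_of_mul_eq_bot
    (J := (Ideal.span A).map (quotLoc p)) (K := (Ideal.span B).map (quotLoc p)) ?_ ?_ ?_ ?_
    (hrs r₁ (by simp)) (hrs r₂ (by simp)) hreg.toIsWeaklyRegular
  · rw [← Ideal.map_mul, ← le_bot_iff, Ideal.map_le_iff_le_comap, Ideal.span_mul_span',
      Ideal.span_le]
    rintro _ ⟨_, ⟨i, ⟨hiF, hai⟩, rfl⟩, _, ⟨j, ⟨hjF, haj⟩, rfl⟩, rfl⟩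
    refine (quotLoc_eq_zero_iff p).2
      ⟨_, hFp, monoW_mul_mem_srIdealW hW hext hF fun G hG hFG _ => ?_⟩
    rw [map_mul, restr_X, restr_X]
    split_ifs with hi hj
    · refine absurd (hai.tail
        ⟨fun h => haj (by rw [← h]; exact hai), mem_link_of_subset hG hFG ?_⟩) haj
      intro x hx
      rcases Finset.mem_insert.1 hx with rfl | hx
      · exact Finset.mem_sdiff.2 ⟨hi, hiF⟩
      · rw [Finset.mem_singleton.1 hx]; exact Finset.mem_sdiff.2 ⟨hj, hjF⟩
    all_goals simp
  · refine le_antisymm (sup_le ?_ ?_) (maximalIdeal_le_of_quotLoc_mem p fun x hx => ?_)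
    · rw [Ideal.map_le_iff_le_comap, Ideal.span_le]
      rintro _ ⟨i, ⟨hiF, -⟩, rfl⟩
      exact (quotLoc_mem_maximalIdeal_iff p).2
        ((mk_mem_facePrime_iff hF).2 (by rw [restr_X, if_neg hiF]))
    · rw [Ideal.map_le_iff_le_comap, Ideal.span_le]
      rintro _ ⟨i, ⟨hiF, -⟩, rfl⟩
      exact (quotLoc_mem_maximalIdeal_iff p).2
        ((mk_mem_facePrime_iff hF).2 (by rw [restr_X, if_neg hiF]))
    · have h := sub_restr_mem_span F x
      rw [(mk_mem_facePrime_iff hF).1 hx, sub_zero] at h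
      rw [← Ideal.map_sup, ← Ideal.span_union]
      refine Ideal.mem_map_of_mem _ (Ideal.span_mono ?_ h)
      rintro _ ⟨i, hi, rfl⟩
      by_cases hai : Relation.ReflTransGen r a i
      · exact Or.inl ⟨i, ⟨hi, hai⟩, rfl⟩
      · exact Or.inr ⟨i, ⟨hi, hai⟩, rfl⟩
  · intro h
    obtain ⟨haW, haF⟩ := hvertex a ha
    refine hne a ha haW ((Submodule.eq_bot_iff _).1 h _ (Ideal.mem_map_of_mem _
      (Ideal.subset_span ⟨⟨a, haW⟩, ⟨haF, .refl⟩, rfl⟩)))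
  · intro h
    obtain ⟨hbW, hbF⟩ := hvertex b hb
    refine hne b hb hbW ((Submodule.eq_bot_iff _).1 h _ (Ideal.mem_map_of_mem _
      (Ideal.subset_span ⟨⟨b, hbW⟩, ⟨hbF, hab⟩, rfl⟩)))

theorem ringSerreS2_iff_linkPreconnected (hW : ∀ F ∈ Δ.faces, F ⊆ W)
    (hle : ∀ F ∈ Δ.faces, F.card ≤ d)
    (hext : ∀ F ∈ Δ.faces, ∃ G ∈ Δ.faces, F ⊆ G ∧ G.card = d) :
    RingSerreS2 (srRingW k W Δ) ↔
      ∀ F ∈ Δ.faces, F.card + 2 ≤ d → LinkPreconnected Δ F :=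
  ⟨fun h _ hF => linkPreconnected_of_ringSerreS2 hW hext h hF,
    ringSerreS2_of_linkPreconnected hW hle hext⟩

end StanleyReisner

section LinkConditions

variable {Δ : SComplex ℕ} {d : ℕ} {F : Finset ℕ}

theorem linkPreconnected_of_reducedH0Vanishes (k : Type*) [Field k]
    (h : (Δ.link F).ReducedH0Vanishes k) : LinkPreconnected Δ F := by
  classical
  intro a b ha hb
  by_contra hab
  set r : ℕ → ℕ → Prop := fun x y => x ≠ y ∧ ({x, y} : Finset ℕ) ∈ (Δ.link F).faces
  have hr : ∀ x y, r x y → r y x := fun x y hxy =>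
    ⟨hxy.1.symm, by rw [Finset.pair_comm]; exact hxy.2⟩
  let φ : (ℕ →₀ k) →ₗ[k] k :=
    Finsupp.linearCombination k fun v => if Relation.ReflTransGen r a v then (1 : k) else 0
  have hφ : ∀ v, φ (Finsupp.single v 1) = if Relation.ReflTransGen r a v then (1 : k) else 0 :=
    fun v => by simp [φ]
  have hsupp : ∀ v ∈ (Finsupp.single a (1 : k) - Finsupp.single b 1).support,
      {v} ∈ (Δ.link F).faces := by
    intro v hv
    rcases Finset.mem_union.1 (Finsupp.support_sub hv) with hv | hv
    · rwa [Finset.mem_singleton.1 (Finsupp.support_single_subset hv)]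
    · rwa [Finset.mem_singleton.1 (Finsupp.support_single_subset hv)]
  have hmem := h (Finsupp.single a 1 - Finsupp.single b 1) hsupp
    (by rw [Finsupp.sum_sub_index fun _ _ _ => rfl]; simp)
  have hker := (Submodule.span_le (p := LinearMap.ker φ)).2 (show {g : ℕ →₀ k | ∃ a b : ℕ, a ≠ b ∧
      ({a, b} : Finset ℕ) ∈ (Δ.link F).faces ∧ g = Finsupp.single a 1 - Finsupp.single b 1} ⊆
        LinearMap.ker φ by
    rintro _ ⟨x, y, hxy, hmem, rfl⟩
    have hiff : Relation.ReflTransGen r a x ↔ Relation.ReflTransGen r a y :=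
      ⟨fun h => h.tail ⟨hxy, hmem⟩, fun h => h.tail (hr _ _ ⟨hxy, hmem⟩)⟩
    rw [SetLike.mem_coe, LinearMap.mem_ker, map_sub, hφ, hφ]
    simp [hiff])
  have h0 := LinearMap.mem_ker.1 (hker hmem)
  rw [map_sub, hφ, hφ, if_pos .refl, if_neg hab] at h0
  simp at h0

theorem LinkPreconnected.reducedH0Vanishes (k : Type*) [Field k]
    (h : LinkPreconnected Δ F) : (Δ.link F).ReducedH0Vanishes k := by
  intro f hf hsum
  rcases f.support.eq_empty_or_nonempty with h0 | ⟨a, ha⟩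
  · rw [Finsupp.support_eq_empty.1 h0]
    exact Submodule.zero_mem _
  have hf' : f = f.sum fun v c => c • (Finsupp.single v (1 : k) - Finsupp.single a 1) := by
    simp only [smul_sub, Finsupp.smul_single, smul_eq_mul, mul_one]
    rw [Finsupp.sum_sub, Finsupp.sum_single]
    have : (f.sum fun _ c => Finsupp.single a c) = Finsupp.single a (f.sum fun _ c => c) := by
      rw [Finsupp.sum, Finsupp.sum, Finsupp.single_finsetSum]
    rw [this, hsum, Finsupp.single_zero, sub_zero]
  rw [hf']
  refine Submodule.sum_mem _ fun v hv => Submodule.smul_mem _ _ ?_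
  have hva := h a v (hf a ha) (hf v hv)
  clear hv
  induction hva with
  | refl => rw [sub_self]; exact Submodule.zero_mem _
  | @tail b c _ hbc ih =>
    rw [← sub_add_sub_cancel _ (Finsupp.single b (1 : k))]
    exact Submodule.add_mem _ (Submodule.subset_span ⟨c, b, hbc.1.symm,
      by rw [Finset.pair_comm]; exact hbc.2, rfl⟩) ih

theorem two_le_dimSucc_link_iff (hle : ∀ F ∈ Δ.faces, F.card ≤ d)
    (hext : ∀ F ∈ Δ.faces, ∃ G ∈ Δ.faces, F ⊆ G ∧ G.card = d) (hF : F ∈ Δ.faces) :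
    2 ≤ (Δ.link F).dimSucc ↔ F.card + 2 ≤ d := by
  obtain ⟨G, hG, hFG, hc⟩ := hext F hF
  have hgr : IsGreatest {n | ∃ T ∈ (Δ.link F).faces, T.card = n} (d - F.card) := by
    refine ⟨⟨G \ F, mem_link_of_subset hG hFG subset_rfl, ?_⟩, ?_⟩
    · rw [Finset.card_sdiff_of_subset hFG, hc]
    · rintro _ ⟨T, ⟨-, hdisj, hT⟩, rfl⟩
      have := hle _ hT
      rw [Finset.card_union_of_disjoint hdisj] at this
      omega
  rw [SComplex.dimSucc, hgr.csSup_eq]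
  omega

theorem connected_link_iff (hext : ∀ F ∈ Δ.faces, ∃ G ∈ Δ.faces, F ⊆ G ∧ G.card = d)
    (hF : F ∈ Δ.faces) (hFd : F.card < d) : (Δ.link F).Connected ↔ LinkPreconnected Δ F := by
  refine ⟨fun h => h.2, fun h => ⟨?_, h⟩⟩
  obtain ⟨G, hG, hFG, hc⟩ := hext F hF
  obtain ⟨v, hvG, hvF⟩ := Finset.exists_mem_notMem_of_card_lt_card (hc ▸ hFd)
  exact ⟨v, mem_link_of_subset hG hFG (by simp [hvG, hvF])⟩

theorem card_le_dimSucc {W : Finset ℕ} (hW : ∀ F ∈ Δ.faces, F ⊆ W) (hF : F ∈ Δ.faces) :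
    F.card ≤ Δ.dimSucc :=
  le_csSup ⟨W.card, by rintro _ ⟨G, hG, rfl⟩; exact Finset.card_le_card (hW G hG)⟩ ⟨F, hF, rfl⟩

theorem SComplex.Pure.exists_card_eq_dimSucc {W : Finset ℕ} (hpure : Δ.Pure)
    (hW : ∀ F ∈ Δ.faces, F ⊆ W) (hF : F ∈ Δ.faces) :
    ∃ G ∈ Δ.faces, F ⊆ G ∧ G.card = Δ.dimSucc := by
  obtain ⟨M, hM, hMc⟩ : Δ.dimSucc ∈ {n | ∃ F ∈ Δ.faces, F.card = n} :=
    Nat.sSup_mem ⟨_, F, hF, rfl⟩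
      ⟨W.card, by rintro _ ⟨G, hG, rfl⟩; exact Finset.card_le_card (hW G hG)⟩
  have hMfacet : Δ.IsFacet M := ⟨hM, fun G hG hMG =>
    Finset.eq_of_subset_of_card_le hMG (hMc ▸ card_le_dimSucc hW hG)⟩
  have hfin : Δ.faces.Finite :=
    W.powerset.finite_toSet.subset fun G hG => Finset.mem_coe.2 (Finset.mem_powerset.2 (hW G hG))
  obtain ⟨G, hFG, hG⟩ := hfin.exists_le_maximal hF
  exact ⟨G, hG.prop, hFG, (hpure ⟨hG.prop, fun H hH hGH => hG.eq_of_le hH hGH⟩ hMfacet).trans hMc⟩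

end LinkConditions

/-- For a pure complex `Δ` of dimension `d - 1` on `[n]`, the
Stanley–Reisner ring `k[Δ]` satisfies Serre's condition `S₂` iff
`H̃₀(link_Δ(F); k) = 0` for all faces `F` with `#F ≤ d - 2`; equivalently, iff
`Δ` is pure and `link_Δ(F)` is connected for every face `F` with
`dim link_Δ(F) ≥ 1`. -/
theorem serreS2_iff_links (k : Type*) [Field k] (n d : ℕ) (Δ : SComplex ℕ)
    (hΔsub : ∀ F ∈ Δ.faces, F ⊆ Finset.Icc 1 n)
    (hpure : Δ.Pure) (hdim : Δ.dimSucc = d) :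
    (RingSerreS2 (srRingW k (Finset.Icc 1 n) Δ) ↔
      ∀ F ∈ Δ.faces, (F.card : ℤ) ≤ (d : ℤ) - 2 → (Δ.link F).ReducedH0Vanishes k) ∧
    (RingSerreS2 (srRingW k (Finset.Icc 1 n) Δ) ↔
      (Δ.Pure ∧ ∀ F ∈ Δ.faces, 2 ≤ (Δ.link F).dimSucc → (Δ.link F).Connected)) := by
  have hle : ∀ F ∈ Δ.faces, F.card ≤ d := fun F hF => hdim ▸ card_le_dimSucc hΔsub hF
  have hext : ∀ F ∈ Δ.faces, ∃ G ∈ Δ.faces, F ⊆ G ∧ G.card = d := fun F hF =>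
    hdim ▸ hpure.exists_card_eq_dimSucc hΔsub hF
  rw [ringSerreS2_iff_linkPreconnected hΔsub hle hext]
  constructor
  · refine forall₂_congr fun F _ => ?_
    rw [show (F.card : ℤ) ≤ (d : ℤ) - 2 ↔ F.card + 2 ≤ d by omega]
    exact imp_congr_right fun _ =>
      ⟨fun h => h.reducedH0Vanishes k, linkPreconnected_of_reducedH0Vanishes k⟩
  · rw [and_iff_right hpure]
    refine forall₂_congr fun F hF => ?_
    rw [two_le_dimSucc_link_iff hle hext hF]
    exact imp_congr_right fun h => (connected_link_iff hext hF (by omega)).symm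
end

section
/- The simplicial complex Δ on {1,…,7} generated by the facets {1,2,3,4} and {1,5,6,7} has the property that link_Δ(F) is connected for every face F ∈ Δ with dim(link_Δ(F)) = 1, yet Δ does not satisfy Serre's condition S₂; indeed link_Δ({1}) is a disconnected complex of dimension 2. -/
open Finset

/-- The simplicial complex generated by the facets `{1,2,3,4}` and `{1,5,6,7}`. -/
def exComplex : SComplex ℕ where
  faces := {F | F ⊆ ({1, 2, 3, 4} : Finset ℕ) ∨ F ⊆ ({1, 5, 6, 7} : Finset ℕ)}
  down_closed := by
    rintro F G (h | h) hG
    · exact Or.inl (hG.trans h)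
    · exact Or.inr (hG.trans h)

namespace SComplex

variable {V : Type*} [DecidableEq V]

/-- If all faces containing `F` lie in a face `A` strictly larger than `F`,
then the link of `F` is a nonempty simplex, hence connected. -/
theorem connected_link_of_forall_subset {Δ : SComplex V} {F A : Finset V} (hA : A ∈ Δ.faces)
    (hFA : F ⊂ A) (h : ∀ G ∈ Δ.faces, F ⊆ G → G ⊆ A) : (Δ.link F).Connected := by
  have hface : ∀ G : Finset V, G ⊆ A → Disjoint G F → G ∈ (Δ.link F).faces := fun G hG hd =>
    ⟨Δ.down_closed hA hG, hd, Δ.down_closed hA (Finset.union_subset hG hFA.1)⟩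
  have hvert : ∀ v, {v} ∈ (Δ.link F).faces → v ∈ A ∧ v ∉ F := fun v ⟨_, hd, hv⟩ =>
    ⟨h _ hv Finset.subset_union_right (by simp), by simpa using hd⟩
  obtain ⟨v, hvA, hvF⟩ := Finset.exists_of_ssubset hFA
  refine ⟨⟨v, hface _ (by simpa using hvA) (by simpa using hvF)⟩, fun a b ha hb => ?_⟩
  obtain ⟨haA, haF⟩ := hvert a ha
  obtain ⟨hbA, hbF⟩ := hvert b hb
  by_cases hab : a = b
  · rw [hab]
  · refine .single ⟨hab, hface _ ?_ ?_⟩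
    · simp [Finset.insert_subset_iff, haA, hbA]
    · simp [haF, hbF]

end SComplex

theorem card_le_of_mem_exComplex {F : Finset ℕ} (hF : F ∈ exComplex.faces) : F.card ≤ 4 := by
  rcases hF with h | h <;> exact (Finset.card_le_card h).trans (by decide)

theorem exists_facet_of_mem_exComplex {F : Finset ℕ} (hF : F ∈ exComplex.faces) :
    ∃ A ∈ exComplex.faces, F ⊆ A ∧ A.card = 4 := by
  rcases hF with h | h
  · exact ⟨_, Or.inl subset_rfl, h, rfl⟩
  · exact ⟨_, Or.inr subset_rfl, h, rfl⟩

theorem dimSucc_link_exComplex {F : Finset ℕ} (hF : F ∈ exComplex.faces) :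
    (exComplex.link F).dimSucc = 4 - F.card := by
  obtain ⟨A, hA, hFA, hcard⟩ := exists_facet_of_mem_exComplex hF
  refine IsGreatest.csSup_eq ⟨⟨A \ F, ⟨exComplex.down_closed hA Finset.sdiff_subset,
    Finset.sdiff_disjoint, ?_⟩, ?_⟩, ?_⟩
  · rwa [Finset.sdiff_union_of_subset hFA]
  · rw [Finset.card_sdiff_of_subset hFA, hcard]
  · rintro n ⟨G, ⟨_, hd, hG⟩, rfl⟩
    have := card_le_of_mem_exComplex hG
    rw [Finset.card_union_of_disjoint hd] at this
    omega

theorem connected_link_exComplex {F : Finset ℕ} (hF : F ∈ exComplex.faces)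
    (hcard : F.card = 2) : (exComplex.link F).Connected := by
  obtain ⟨x, hxF, hx⟩ : ∃ x ∈ F, x ≠ 1 := Finset.exists_mem_ne (by omega) 1
  have hss : ∀ A : Finset ℕ, F ⊆ A → A.card = 4 → F ⊂ A := fun A h hA =>
    h.ssubset_of_ne (by rintro rfl; omega)
  rcases hF with h | h
  · refine SComplex.connected_link_of_forall_subset (Or.inl subset_rfl) (hss _ h rfl) ?_
    rintro G (hG | hG) hFG
    · exact hG
    · have h₁ := h hxF
      have h₂ := hG (hFG hxF)
      simp only [Finset.mem_insert, Finset.mem_singleton] at h₁ h₂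
      omega
  · refine SComplex.connected_link_of_forall_subset (Or.inr subset_rfl) (hss _ h rfl) ?_
    rintro G (hG | hG) hFG
    · have h₁ := h hxF
      have h₂ := hG (hFG hxF)
      simp only [Finset.mem_insert, Finset.mem_singleton] at h₁ h₂
      omega
    · exact hG

theorem not_connected_link_singleton_one : ¬ (exComplex.link {1}).Connected := by
  rintro ⟨-, h⟩
  have h25 := h 2 5 ⟨Or.inl (by decide), by decide, Or.inl (by decide)⟩
    ⟨Or.inr (by decide), by decide, Or.inr (by decide)⟩
  have hstay : ∀ b, Relation.ReflTransGen
      (fun x y => x ≠ y ∧ ({x, y} : Finset ℕ) ∈ (exComplex.link {1}).faces) 2 b →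
      b ∈ ({2, 3, 4} : Finset ℕ) := by
    intro b hb
    induction hb with
    | refl => decide
    | @tail x y _ hxy ih =>
      obtain ⟨-, hf, hd, -⟩ := hxy
      have hy : y ≠ 1 := by rintro rfl; simp at hd
      rcases hf with hf | hf <;>
      · have hx := hf (Finset.mem_insert_self x {y})
        have hy' := hf (Finset.mem_insert_of_mem (Finset.mem_singleton_self y))
        simp only [Finset.mem_insert, Finset.mem_singleton] at ih hx hy' ⊢
        omega
  exact absurd (hstay 5 h25) (by decide)

section Depth

open scoped Pointwise

/-- If the maximal ideal of a local ring is the sum of two nonzero ideals with zero intersection,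
then every regular sequence in the maximal ideal has length at most one. -/
theorem IsLocalRing.length_le_one_of_isRegular {A : Type*} [CommRing A] [IsLocalRing A]
    {I J : Ideal A} (hinf : I ⊓ J = ⊥) (hsup : I ⊔ J = maximalIdeal A) (hI : I ≠ ⊥) (hJ : J ≠ ⊥)
    {rs : List A} (hmem : ∀ r ∈ rs, r ∈ maximalIdeal A)
    (hreg : RingTheory.Sequence.IsRegular A rs) : rs.length ≤ 1 := by
  have hzero : ∀ x ∈ I, x ∈ J → x = 0 := fun x hx hx' => by
    simpa [hinf] using (show x ∈ I ⊓ J from ⟨hx, hx'⟩)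
  have hmul : ∀ x ∈ I, ∀ y ∈ J, x * y = 0 := fun x hx y hy =>
    hzero _ (I.mul_mem_right _ hx) (J.mul_mem_left _ hy)
  match rs with
  | [] => simp
  | [_] => simp
  | r :: s :: _ =>
    exfalso
    have hw := hreg.toIsWeaklyRegular
    rw [RingTheory.Sequence.isWeaklyRegular_cons_iff,
      RingTheory.Sequence.isWeaklyRegular_cons_iff] at hw
    obtain ⟨hr, hs, -⟩ := hw
    replace hr : ∀ x, r * x = 0 → x = 0 := isSMulRegular_iff_right_eq_zero_of_smul.mp hr
    have hrmem : r ∈ I ⊔ J := hsup ▸ hmem r (by simp)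
    have hsmem : s ∈ I ⊔ J := hsup ▸ hmem s (by simp)
    obtain ⟨a, ha, b, hb, rfl⟩ := Submodule.mem_sup.mp hrmem
    obtain ⟨c, hc, d, hd, rfl⟩ := Submodule.mem_sup.mp hsmem
    have ha0 : a ≠ 0 := by
      rintro rfl
      refine hI ((Submodule.eq_bot_iff I).mpr fun x hx => hr x ?_)
      linear_combination hmul x hx b hb
    have hb0 : b ≠ 0 := by
      rintro rfl
      refine hJ ((Submodule.eq_bot_iff J).mpr fun x hx => hr x ?_)
      linear_combination hmul a ha x hx
    have key : a ∈ (a + b) • (⊤ : Submodule A A) := by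
      refine mem_of_isSMulRegular_quotient_of_smul_mem hs
        ((Submodule.mem_smul_pointwise_iff_exists _ _ _).mpr ⟨c, trivial, ?_⟩)
      simp only [smul_eq_mul]
      linear_combination hmul c hc b hb - hmul a ha d hd
    obtain ⟨t, -, ht⟩ := (Submodule.mem_smul_pointwise_iff_exists _ _ _).mp key
    rw [smul_eq_mul] at ht
    have h₁ : a * (1 - t) = 0 := by
      refine hzero _ (I.mul_mem_right _ ha) ?_
      rw [show a * (1 - t) = b * t by linear_combination -ht]
      exact J.mul_mem_right _ hb
    have h₂ : b * t = 0 := by linear_combination ht + h₁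
    rcases IsLocalRing.isUnit_or_isUnit_one_sub_self t with hu | hu
    · exact hb0 (hu.mul_left_eq_zero.mp h₂)
    · exact ha0 (hu.mul_left_eq_zero.mp h₁)

theorem Ideal.map_localization_ne_bot {R : Type*} [CommRing R] {I J p : Ideal R} [J.IsPrime]
    [p.IsPrime] (hJp : J ≤ p) (hIJ : ¬ I ≤ J) :
    I.map (algebraMap R (Localization.AtPrime p)) ≠ ⊥ := by
  intro h
  refine hIJ fun x hx => ?_
  have hx0 : algebraMap R (Localization.AtPrime p) x = 0 := by
    simpa [h] using Ideal.mem_map_of_mem (algebraMap R (Localization.AtPrime p)) hx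
  obtain ⟨⟨m, hm⟩, hmx⟩ := (IsLocalization.map_eq_zero_iff p.primeCompl _ x).mp hx0
  exact (Ideal.IsPrime.mem_or_mem ‹J.IsPrime› (hmx ▸ J.zero_mem : m * x ∈ J)).resolve_left
    fun hmJ => hm (hJp hmJ)

/-- A ring in which zero is the intersection of two incomparable primes whose sum is a prime
of height at least two does not satisfy `S₂`. -/
theorem not_ringSerreS2_of_inf_eq_bot {R : Type*} [CommRing R] {I J p : Ideal R} [I.IsPrime]
    [J.IsPrime] [p.IsPrime] (hinf : I ⊓ J = ⊥) (hsup : I ⊔ J = p) (hIJ : ¬ I ≤ J) (hJI : ¬ J ≤ I)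
    (hp : 2 ≤ p.height) : ¬ RingSerreS2 R := by
  intro h
  obtain ⟨rs, hmem, hreg, hlen⟩ := h p
  have hle : rs.length ≤ 1 := by
    refine IsLocalRing.length_le_one_of_isRegular
      (I := I.map (algebraMap R (Localization.AtPrime p)))
      (J := J.map (algebraMap R (Localization.AtPrime p))) ?_ ?_
      (Ideal.map_localization_ne_bot (hsup ▸ le_sup_right) hIJ)
      (Ideal.map_localization_ne_bot (hsup ▸ le_sup_left) hJI) hmem hreg
    · rw [← IsLocalization.map_inf p.primeCompl, hinf, Ideal.map_bot]
    · rw [← Ideal.map_sup, hsup, Localization.AtPrime.map_eq_maximalIdeal]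
  have hp' : (2 : WithBot ℕ∞) ≤ p.height := WithBot.coe_le_coe.mpr hp
  rw [IsLocalization.AtPrime.ringKrullDim_eq_height p, min_eq_left hp'] at hlen
  have : 2 ≤ rs.length := by exact_mod_cast hlen
  omega

end Depth

section VariableIdeals

open MvPolynomial

variable {σ k : Type*} [Field k]

theorem MvPolynomial.isPrime_span_X_image (s : Set σ) :
    (Ideal.span (X '' s : Set (MvPolynomial σ k))).IsPrime := by
  classical
  set P : Ideal (MvPolynomial σ k) := Ideal.span (X '' s)
  let φ : MvPolynomial σ k →ₐ[k] MvPolynomial σ k := aeval fun i => if i ∈ s then 0 else X i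
  have hφ : (Ideal.Quotient.mkₐ k P).comp φ = Ideal.Quotient.mkₐ k P := by
    refine MvPolynomial.algHom_ext fun i => ?_
    by_cases hi : i ∈ s
    · have : Ideal.Quotient.mk P (X i) = 0 :=
        Ideal.Quotient.eq_zero_iff_mem.mpr (Ideal.subset_span ⟨i, hi, rfl⟩)
      simp [φ, hi, this]
    · simp [φ, hi]
  have hker : P = RingHom.ker φ := by
    refine le_antisymm (Ideal.span_le.mpr ?_) fun f hf => ?_
    · rintro _ ⟨i, hi, rfl⟩
      simp [φ, hi]
    · have := congrArg (fun ψ => ψ f) hφ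
      simp only [AlgHom.comp_apply, (RingHom.mem_ker).mp hf, map_zero] at this
      exact Ideal.Quotient.eq_zero_iff_mem.mp this.symm
  rw [hker]
  exact RingHom.ker_isPrime φ

theorem MvPolynomial.span_X_image_le_iff {s t : Set σ} :
    Ideal.span (X '' s : Set (MvPolynomial σ k)) ≤ Ideal.span (X '' t) ↔ s ⊆ t := by
  refine ⟨fun h i hi => ?_, fun h => Ideal.span_mono (Set.image_mono h)⟩
  have hX : (X i : MvPolynomial σ k) ∈ Ideal.span (X '' t) :=
    h (Ideal.subset_span ⟨i, hi, rfl⟩)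
  obtain ⟨j, hj, hne⟩ := mem_ideal_span_X_image.mp hX (Finsupp.single i 1) (by
    classical simp [support_X])
  rw [Finsupp.single_apply_ne_zero] at hne
  exact hne.1 ▸ hj

end VariableIdeals

section StanleyReisner

open MvPolynomial

variable (k : Type*) [Field k] (W : Finset ℕ)

/-- The ideal of `k[Δ]` generated by the variables `xᵢ` with `i ∈ S`. -/
noncomputable def srVarIdeal (Δ : SComplex ℕ) (S : Finset ℕ) : Ideal (srRingW k W Δ) :=
  (Ideal.span (X '' {i : {x // x ∈ W} | ↑i ∈ S})).map (Ideal.Quotient.mk (srIdealW k W Δ))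

variable {k W} {Δ : SComplex ℕ} {S T : Finset ℕ}

theorem srIdealW_le_span_X (hS : ∀ F ⊆ W, F ∉ Δ.faces → ∃ i ∈ F, i ∈ S) :
    srIdealW k W Δ ≤ Ideal.span (X '' {i : {x // x ∈ W} | ↑i ∈ S}) := by
  refine Ideal.span_le.mpr ?_
  rintro _ ⟨F, hFW, hF, rfl⟩
  obtain ⟨i, hiF, hiS⟩ := hS F hFW hF
  exact Ideal.mem_of_dvd _ (Finset.dvd_prod_of_mem _ (Finset.mem_subtype.mpr hiF))
    (Ideal.subset_span ⟨⟨i, hFW hiF⟩, hiS, rfl⟩)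

theorem isPrime_srVarIdeal (hS : ∀ F ⊆ W, F ∉ Δ.faces → ∃ i ∈ F, i ∈ S) :
    (srVarIdeal k W Δ S).IsPrime := by
  have := isPrime_span_X_image (k := k) {i : {x // x ∈ W} | ↑i ∈ S}
  exact Ideal.map_isPrime_of_surjective Ideal.Quotient.mk_surjective
    (by simpa using srIdealW_le_span_X hS)

theorem srVarIdeal_le_iff (hSW : S ⊆ W) (hT : ∀ F ⊆ W, F ∉ Δ.faces → ∃ i ∈ F, i ∈ T) :
    srVarIdeal k W Δ S ≤ srVarIdeal k W Δ T ↔ S ⊆ T := by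
  rw [srVarIdeal, Ideal.map_le_iff_le_comap, srVarIdeal,
    Ideal.comap_map_mk (srIdealW_le_span_X hT), span_X_image_le_iff]
  exact ⟨fun h i hi => h (a := ⟨i, hSW hi⟩) hi, fun h i hi => h hi⟩

theorem srVarIdeal_lt (hTW : T ⊆ W) (hS : ∀ F ⊆ W, F ∉ Δ.faces → ∃ i ∈ F, i ∈ S) (h : S ⊂ T) :
    srVarIdeal k W Δ S < srVarIdeal k W Δ T := by
  refine lt_of_le_not_ge ?_ fun hle => h.2 ((srVarIdeal_le_iff hTW hS).mp hle)
  exact Ideal.map_mono (Ideal.span_mono (Set.image_mono fun i hi => h.1 hi))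

theorem srVarIdeal_union : srVarIdeal k W Δ (S ∪ T) = srVarIdeal k W Δ S ⊔ srVarIdeal k W Δ T := by
  rw [srVarIdeal, srVarIdeal, srVarIdeal, ← Ideal.map_sup, ← Ideal.span_union, ← Set.image_union]
  congr 3
  ext i
  simp

theorem monoW_mem_srIdealW {F : Finset ℕ} (hFW : F ⊆ W) (hF : F ∉ Δ.faces) :
    monoW k W F ∈ srIdealW k W Δ :=
  Ideal.subset_span ⟨F, hFW, hF, rfl⟩

theorem monoW_pair {i j : {x // x ∈ W}} (hij : i ≠ j) :
    monoW k W {↑i, ↑j} = monomial (Finsupp.single i 1 + Finsupp.single j 1) 1 := by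
  have : Finset.subtype (· ∈ W) {(i : ℕ), (j : ℕ)} = {i, j} := by
    ext a
    simp only [Finset.mem_subtype, Finset.mem_insert, Finset.mem_singleton, Subtype.coe_inj]
  rw [monoW, this, Finset.prod_pair hij, X, X, monomial_mul, one_mul]

theorem inf_span_X_le_srIdealW (hd : Disjoint S T)
    (hST : ∀ i ∈ S, ∀ j ∈ T, ({i, j} : Finset ℕ) ∉ Δ.faces) :
    Ideal.span (X '' {i : {x // x ∈ W} | ↑i ∈ S}) ⊓ Ideal.span (X '' {i : {x // x ∈ W} | ↑i ∈ T})
      ≤ srIdealW k W Δ := by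
  intro f hf
  rw [Ideal.mem_inf, mem_ideal_span_X_image, mem_ideal_span_X_image] at hf
  rw [← support_sum_monomial_coeff f]
  refine Ideal.sum_mem _ fun m hm => ?_
  obtain ⟨i, hi, hmi⟩ := hf.1 m hm
  obtain ⟨j, hj, hmj⟩ := hf.2 m hm
  have hij : i ≠ j := by
    rintro rfl
    exact Finset.disjoint_left.mp hd hi hj
  have hle : Finsupp.single i 1 + Finsupp.single j 1 ≤ m := by
    intro a
    by_cases hai : i = a
    · subst hai
      simpa [hij.symm, Nat.one_le_iff_ne_zero] using hmi
    · by_cases haj : j = a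
      · subst haj
        simpa [hai, Nat.one_le_iff_ne_zero] using hmj
      · simp [hai, haj]
  have hmem : monoW k W {↑i, ↑j} ∈ srIdealW k W Δ :=
    monoW_mem_srIdealW (Finset.insert_subset i.2 (Finset.singleton_subset_iff.mpr j.2))
      (hST i hi j hj)
  refine Ideal.mem_of_dvd _ ?_ hmem
  rw [monoW_pair hij, monomial_dvd_monomial]
  exact ⟨Or.inr hle, one_dvd _⟩

/-- If no edge of `Δ` joins the disjoint sets `S` and `T`, then the corresponding ideals generated
by variables intersect trivially. -/
theorem srVarIdeal_inf_eq_bot (hd : Disjoint S T)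
    (hST : ∀ i ∈ S, ∀ j ∈ T, ({i, j} : Finset ℕ) ∉ Δ.faces)
    (hS : ∀ F ⊆ W, F ∉ Δ.faces → ∃ i ∈ F, i ∈ S) (hT : ∀ F ⊆ W, F ∉ Δ.faces → ∃ i ∈ F, i ∈ T) :
    srVarIdeal k W Δ S ⊓ srVarIdeal k W Δ T = ⊥ := by
  rw [← Ideal.map_comap_of_surjective _ Ideal.Quotient.mk_surjective
      (srVarIdeal k W Δ S ⊓ srVarIdeal k W Δ T), Ideal.comap_inf, srVarIdeal, srVarIdeal,
    Ideal.comap_map_mk (srIdealW_le_span_X hS), Ideal.comap_map_mk (srIdealW_le_span_X hT),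
    Ideal.map_eq_bot_iff_le_ker, Ideal.mk_ker]
  exact inf_span_X_le_srIdealW hd hST

end StanleyReisner

theorem exists_mem_of_notMem_exComplex {S : Finset ℕ} (h : {2, 3, 4} ⊆ S ∨ {5, 6, 7} ⊆ S) :
    ∀ F ⊆ Finset.Icc 1 7, F ∉ exComplex.faces → ∃ i ∈ F, i ∈ S := by
  intro F hFW hF
  by_contra! hFS
  refine hF (h.elim (fun h => Or.inr fun x hx => ?_) (fun h => Or.inl fun x hx => ?_)) <;>
  · have h₁ := Finset.mem_Icc.mp (hFW hx)
    have h₂ := mt (@h x) (hFS x hx)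
    simp only [Finset.mem_insert, Finset.mem_singleton] at h₂ ⊢
    omega

theorem not_ringSerreS2_exComplex (k : Type*) [Field k] :
    ¬ RingSerreS2 (srRingW k (Finset.Icc 1 7) exComplex) := by
  have hcovS := exists_mem_of_notMem_exComplex (S := {2, 3, 4}) (by decide)
  have hcovT := exists_mem_of_notMem_exComplex (S := {5, 6, 7}) (by decide)
  have hcovU := exists_mem_of_notMem_exComplex (S := {2, 3, 4, 5}) (by decide)
  have hcovP := exists_mem_of_notMem_exComplex (S := {2, 3, 4} ∪ {5, 6, 7}) (by decide)
  have := isPrime_srVarIdeal (k := k) hcovS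
  have := isPrime_srVarIdeal (k := k) hcovT
  have := isPrime_srVarIdeal (k := k) hcovU
  have := isPrime_srVarIdeal (k := k) hcovP
  refine not_ringSerreS2_of_inf_eq_bot
    (srVarIdeal_inf_eq_bot (k := k) (by decide) ?_ hcovS hcovT) srVarIdeal_union.symm
    (mt (srVarIdeal_le_iff (by decide) hcovT).mp (by decide))
    (mt (srVarIdeal_le_iff (by decide) hcovS).mp (by decide)) ?_
  · intro i hi j hj h
    change _ ∨ _ at h
    simp only [Finset.insert_subset_iff, Finset.singleton_subset_iff, Finset.mem_insert,
      Finset.mem_singleton] at hi hj h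
    omega
  · have h₁ := Ideal.height_add_one_le_of_lt_of_isPrime
      (srVarIdeal_lt (k := k) (T := {2, 3, 4, 5}) (by decide) hcovS (by decide))
    have h₂ := Ideal.height_add_one_le_of_lt_of_isPrime
      (srVarIdeal_lt (k := k) (T := {2, 3, 4} ∪ {5, 6, 7}) (by decide) hcovU (by decide))
    calc (2 : ℕ∞) = 0 + 1 + 1 := by norm_num
      _ ≤ (srVarIdeal k (Finset.Icc 1 7) exComplex {2, 3, 4}).height + 1 + 1 := by
        gcongr
        exact zero_le
      _ ≤ _ := (add_le_add_left h₁ 1).trans h₂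

/-- The complex generated by `{1,2,3,4}` and `{1,5,6,7}` has
connected one-dimensional links, yet fails `S₂`; indeed `link({1})` is a
disconnected complex of dimension `2`. -/
theorem exComplex_properties (k : Type*) [Field k] :
    (∀ F ∈ exComplex.faces, (exComplex.link F).dimSucc = 2 → (exComplex.link F).Connected) ∧
    ¬ RingSerreS2 (srRingW k (Finset.Icc 1 7) exComplex) ∧
    ¬ (exComplex.link {1}).Connected ∧ (exComplex.link {1}).dimSucc = 3 := by
  refine ⟨fun F hF h => connected_link_exComplex hF ?_, not_ringSerreS2_exComplex k,
    not_connected_link_singleton_one, ?_⟩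
  · rw [dimSucc_link_exComplex hF] at h
    omega
  · rw [dimSucc_link_exComplex (Or.inl (by decide))]
    rfl
end
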